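/- arXiv:1603.04193 — 2 statements merged into one kernel-verified Lean document; each statement's English description precedes it below -/
import Mathlib

section
/- Let X ⊆ ℝⁿ be a real algebraic set of dimension 1 and let f be a continuous semi-algebraic function on X. There exists a polynomial function p on X such that sign(f) = sign(p) on X if and only if Z(f) is Zariski closed, i.e. Z(f) is a real algebraic subset of X. -/
open MvPolynomial Set

/-- A real algebraic set: the common zero locus of finitely many real polynomials. -/
def IsRealAlgebraicSet {n : ℕ} (X : Set (Fin n → ℝ)) : Prop :=
  ∃ (k : ℕ) (p : Fin k → MvPolynomial (Fin n) ℝ),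
    X = {x | ∀ i, MvPolynomial.eval x (p i) = 0}

/-- `V` is a real algebraic subset of `X`, i.e. a Zariski closed subset of `X`. -/
def IsZariskiClosedIn {n : ℕ} (X V : Set (Fin n → ℝ)) : Prop :=
  IsRealAlgebraicSet V ∧ V ⊆ X

/-- `U` is a Zariski open subset of `X`. -/
def IsZariskiOpenIn {n : ℕ} (X U : Set (Fin n → ℝ)) : Prop :=
  U ⊆ X ∧ IsRealAlgebraicSet (X \ U)

/-- `U` is Zariski dense in `X`. -/
def IsZariskiDenseIn {n : ℕ} (X U : Set (Fin n → ℝ)) : Prop :=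
  ∀ V, IsZariskiClosedIn X V → U ⊆ V → V = X

/-- `f` is regular on `U` : on `U`, `f = p / q` with `q` nonvanishing on `U`. -/
def IsRegularOnSet {n : ℕ} (U : Set (Fin n → ℝ)) (f : (Fin n → ℝ) → ℝ) : Prop :=
  ∃ p q : MvPolynomial (Fin n) ℝ,
    (∀ x ∈ U, MvPolynomial.eval x q ≠ 0) ∧
    ∀ x ∈ U, f x = MvPolynomial.eval x p / MvPolynomial.eval x q

/-- A rational continuous function on `X`: continuous on `X` (euclidean topology) and
regular on a Zariski-dense Zariski-open subset of `X`. -/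
def IsRatCont {n : ℕ} (X : Set (Fin n → ℝ)) (f : (Fin n → ℝ) → ℝ) : Prop :=
  ContinuousOn f X ∧
    ∃ U, IsZariskiOpenIn X U ∧ IsZariskiDenseIn X U ∧ IsRegularOnSet U f

/-- A regulous function on `ℝⁿ`: continuous, and equal to a quotient of polynomials on a
nonempty Zariski open subset of `ℝⁿ`. -/
def IsRegulous {n : ℕ} (f : (Fin n → ℝ) → ℝ) : Prop :=
  Continuous f ∧
    ∃ U : Set (Fin n → ℝ), IsZariskiOpenIn Set.univ U ∧ U.Nonempty ∧ IsRegularOnSet U f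

/-- A regulous function on `X`: the restriction to `X` of a regulous function on `ℝⁿ`. -/
def IsRegulousOn {n : ℕ} (X : Set (Fin n → ℝ)) (f : (Fin n → ℝ) → ℝ) : Prop :=
  ∃ g : (Fin n → ℝ) → ℝ, IsRegulous g ∧ ∀ x ∈ X, f x = g x

/-- The largest Zariski open subset of `X` on which `f` is regular. -/
def regularDomain {n : ℕ} (X : Set (Fin n → ℝ)) (f : (Fin n → ℝ) → ℝ) : Set (Fin n → ℝ) :=
  ⋃₀ {U | IsZariskiOpenIn X U ∧ IsRegularOnSet U f}

/-- The polar locus of `f` on `X`. -/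
def polarLocus {n : ℕ} (X : Set (Fin n → ℝ)) (f : (Fin n → ℝ) → ℝ) : Set (Fin n → ℝ) :=
  X \ regularDomain X f

/-- The ideal of polynomials vanishing on `X`. -/
noncomputable def vanishingIdealOf {n : ℕ} (X : Set (Fin n → ℝ)) : Ideal (MvPolynomial (Fin n) ℝ) where
  carrier := {p | ∀ x ∈ X, MvPolynomial.eval x p = 0}
  add_mem' := by
    intro a b ha hb x hx
    simp [map_add, ha x hx, hb x hx]
  zero_mem' := by intro x hx; simp
  smul_mem' := by
    intro c p hp x hx
    simp [smul_eq_mul, map_mul, hp x hx]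

/-- The dimension of `X`: the Krull dimension of its coordinate ring. -/
noncomputable def algDim {n : ℕ} (X : Set (Fin n → ℝ)) : WithBot ℕ∞ :=
  ringKrullDim (MvPolynomial (Fin n) ℝ ⧸ vanishingIdealOf X)

/-- `x` is a regular (nonsingular) point of `X`: locally around `x`, `X` is the common zero
set of `n - d` polynomials (`d = dim X`) whose gradients at `x` are linearly independent. -/
def IsRegularPoint {n : ℕ} (X : Set (Fin n → ℝ)) (x : Fin n → ℝ) : Prop :=
  x ∈ X ∧ ∃ d : ℕ, algDim X = (d : WithBot ℕ∞) ∧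
    ∃ (p : Fin (n - d) → MvPolynomial (Fin n) ℝ) (U : Set (Fin n → ℝ)),
      IsOpen U ∧ x ∈ U ∧
      X ∩ U = {y ∈ U | ∀ j, MvPolynomial.eval y (p j) = 0} ∧
      LinearIndependent ℝ fun j : Fin (n - d) =>
        fun i : Fin n => MvPolynomial.eval x (MvPolynomial.pderiv i (p j))

/-- `X` is central: it is the euclidean closure of its set of regular points. -/
def IsCentral {n : ℕ} (X : Set (Fin n → ℝ)) : Prop :=
  closure {x | IsRegularPoint X x} = X

/-- A semi-algebraic subset of `ℝᵐ`: a finite union of sets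
`{x | p x = 0, q₁ x > 0, …, q_k x > 0}`. -/
def IsSemialgebraic {m : ℕ} (S : Set (Fin m → ℝ)) : Prop :=
  ∃ (N : ℕ) (P : Fin N → MvPolynomial (Fin m) ℝ) (k : Fin N → ℕ)
    (Q : (i : Fin N) → Fin (k i) → MvPolynomial (Fin m) ℝ),
    S = ⋃ i, {x | MvPolynomial.eval x (P i) = 0 ∧ ∀ j, 0 < MvPolynomial.eval x (Q i j)}

/-- The graph of `f : X → ℝ`, as a subset of `ℝⁿ⁺¹`. -/
def graphOn {n : ℕ} (X : Set (Fin n → ℝ)) (f : (Fin n → ℝ) → ℝ) : Set (Fin (n + 1) → ℝ) :=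
  {y | (fun i : Fin n => y i.castSucc) ∈ X ∧ y (Fin.last n) = f fun i : Fin n => y i.castSucc}

/-- `f` is a semi-algebraic function on `X`: its graph is semi-algebraic in `ℝⁿ⁺¹`. -/
def IsSemialgebraicFnOn {n : ℕ} (X : Set (Fin n → ℝ)) (f : (Fin n → ℝ) → ℝ) : Prop :=
  IsSemialgebraic (graphOn X f)

/-- The interior of `S` in `X` for the euclidean topology of `X`. -/
def interiorIn {n : ℕ} (X S : Set (Fin n → ℝ)) : Set (Fin n → ℝ) :=
  {x ∈ X | ∃ U, IsOpen U ∧ x ∈ U ∧ U ∩ X ⊆ S}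

/-- The euclidean boundary of `S` in `X`: closure of `S` in `X` minus interior of `S` in `X`. -/
def bdIn {n : ℕ} (X S : Set (Fin n → ℝ)) : Set (Fin n → ℝ) :=
  (closure S ∩ X) \ interiorIn X S

/-- The Zariski closure of `E` in `X`: the smallest real algebraic subset of `X`
containing `E`. -/
def zarClosureIn {n : ℕ} (X E : Set (Fin n → ℝ)) : Set (Fin n → ℝ) :=
  ⋂₀ {V | IsZariskiClosedIn X V ∧ E ⊆ V}

/-- `V` is a regulous closed subset of `X`: the zero set of a regulous function on `X`. -/
def IsRegulousClosedIn {n : ℕ} (X V : Set (Fin n → ℝ)) : Prop :=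
  ∃ f : (Fin n → ℝ) → ℝ, IsRegulousOn X f ∧ V = {x ∈ X | f x = 0}

/-- The regulous closure of `E` in `X`: the smallest regulous closed subset of `X`
containing `E`. -/
def regClosureIn {n : ℕ} (X E : Set (Fin n → ℝ)) : Set (Fin n → ℝ) :=
  ⋂₀ {V | IsRegulousClosedIn X V ∧ E ⊆ V}

/-- `X` is an irreducible real algebraic set: it is not the union of two proper real
algebraic subsets. -/
def IsIrreducibleAlgSet {n : ℕ} (X : Set (Fin n → ℝ)) : Prop :=
  IsRealAlgebraicSet X ∧
    ∀ V W : Set (Fin n → ℝ), IsZariskiClosedIn X V → IsZariskiClosedIn X W →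
      X = V ∪ W → V = X ∨ W = X

section helpers


lemma aux_height (M : ℕ) : ∀ k : ℕ, k ≤ M → ∀ P : Ideal (MvPolynomial (Fin M) ℂ),
    P = RingHom.ker (MvPolynomial.aeval (R := ℂ)
      (fun i : Fin M => if (i : ℕ) < k then (0 : MvPolynomial (Fin M) ℂ) else X i)) →
    (k : ℕ∞) ≤ P.height := by
  intro k
  induction k with
  | zero => intro _ P _; simp
  | succ k ih =>
    intro hk P hP
    have h1 := ih (by omega) _ rfl
    set Q := RingHom.ker (MvPolynomial.aeval (R := ℂ)
      (fun i : Fin M => if (i : ℕ) < k then (0 : MvPolynomial (Fin M) ℂ) else X i)) with hQ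
    have : Q.IsPrime := RingHom.ker_isPrime _
    have : P.IsPrime := hP ▸ RingHom.ker_isPrime _
    have hlt : Q < P := by
      refine lt_of_le_of_ne ?_ ?_
      · intro p hp
        rw [hP, RingHom.mem_ker]
        rw [hQ, RingHom.mem_ker] at hp
        have hcomp : (MvPolynomial.aeval (R := ℂ)
            (fun i : Fin M => if (i : ℕ) < k + 1 then (0 : MvPolynomial (Fin M) ℂ) else X i)) =
            (MvPolynomial.aeval (R := ℂ)
            (fun i : Fin M => if (i : ℕ) < k + 1 then (0 : MvPolynomial (Fin M) ℂ) else X i)).comp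
            (MvPolynomial.aeval (R := ℂ)
            (fun i : Fin M => if (i : ℕ) < k then (0 : MvPolynomial (Fin M) ℂ) else X i)) := by
          apply MvPolynomial.algHom_ext
          intro i
          simp only [AlgHom.comp_apply, aeval_X]
          by_cases h : (i : ℕ) < k
          · simp [h, Nat.lt_succ_of_lt h]
          · simp [h]
        rw [hcomp, AlgHom.comp_apply, hp, map_zero]
      · intro h
        have h2 : (X ⟨k, by omega⟩ : MvPolynomial (Fin M) ℂ) ∈ P := by
          rw [hP, RingHom.mem_ker]; simp
        rw [← h, hQ, RingHom.mem_ker] at h2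
        simp at h2
    have h3 := Ideal.height_add_one_le_of_lt_of_isPrime hlt
    push_cast
    exact le_trans (by gcongr) h3

lemma exists_nonzero_zero {M : ℕ} {ι : Type*} [Fintype ι] (hN : Fintype.card ι < M)
    (p : ι → MvPolynomial (Fin M) ℂ) (hp : ∀ i, eval 0 (p i) = 0) :
    ∃ x : Fin M → ℂ, x ≠ 0 ∧ ∀ i, eval x (p i) = 0 := by
  by_contra hcon
  push Not at hcon
  set I : Ideal (MvPolynomial (Fin M) ℂ) := Ideal.span (Set.range p) with hI
  have hz : zeroLocus ℂ I = {0} := by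
    rw [hI, zeroLocus_span]
    ext x
    simp only [Set.mem_range, forall_exists_index, forall_apply_eq_imp_iff, Set.mem_ofPred_eq,
      Set.mem_singleton_iff]
    constructor
    · intro h
      by_contra hx
      obtain ⟨i, hi⟩ := hcon x hx
      exact hi (by simpa [aeval_eq_eval] using h i)
    · rintro rfl i
      simpa [aeval_eq_eval] using hp i
  have hrad := MvPolynomial.vanishingIdeal_zeroLocus_eq_radical (K := ℂ) I
  rw [hz] at hrad
  set m : Ideal (MvPolynomial (Fin M) ℂ) := vanishingIdeal ℂ ({0} : Set (Fin M → ℂ)) with hm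
  have hmp : m.IsPrime := by rw [hm]; infer_instance
  have hmin : m ∈ I.minimalPrimes := by
    refine ⟨⟨hmp, ?_⟩, ?_⟩
    · rw [hrad]; exact Ideal.le_radical
    · rintro q ⟨hq, hIq⟩ _
      rw [hrad]
      exact hq.radical_le_iff.2 hIq
  have h1 := Ideal.height_le_card_of_mem_minimalPrimes_span (Set.finite_range p) hmin
  have h2 : (M : ℕ∞) ≤ m.height := by
    apply aux_height M M le_rfl
    ext q
    rw [hm, mem_vanishingIdeal_singleton_iff, RingHom.mem_ker]
    have : (MvPolynomial.aeval (R := ℂ)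
      (fun i : Fin M => if (i : ℕ) < M then (0 : MvPolynomial (Fin M) ℂ) else X i)) =
      (Algebra.ofId ℂ (MvPolynomial (Fin M) ℂ)).comp (aeval (0 : Fin M → ℂ)) := by
      apply MvPolynomial.algHom_ext
      intro i
      simp
    rw [this, AlgHom.comp_apply]
    constructor
    · intro h; rw [h, map_zero]
    · intro h
      have : (C (aeval (0 : Fin M → ℂ) q) : MvPolynomial (Fin M) ℂ) = 0 := h
      simpa using this
  have h3 : (Set.range p).ncard ≤ Fintype.card ι := by
    classical
    rw [Set.ncard_eq_toFinset_card', Set.toFinset_range]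
    exact Finset.card_image_le
  have h4 : (M : ℕ∞) ≤ ((Set.range p).ncard : ℕ∞) := h2.trans h1
  have h5 : M ≤ (Set.range p).ncard := by exact_mod_cast h4
  omega

lemma exists_bilin {U W : Type*} [AddCommGroup U] [Module ℝ U] [FiniteDimensional ℝ U]
    [AddCommGroup W] [Module ℝ W] [FiniteDimensional ℝ W]
    (B : U →ₗ[ℝ] U →ₗ[ℝ] W) (hB : ∀ u v, B u v = B v u)
    (hd : Module.finrank ℝ W < Module.finrank ℝ U) :
    ∃ v1 v2 : U, (v1 ≠ 0 ∨ v2 ≠ 0) ∧ B v1 v1 = B v2 v2 ∧ B v1 v2 = 0 := by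
  set e := Module.finBasis ℝ U
  set b := Module.finBasis ℝ W
  obtain ⟨ξ, hξ, hzero⟩ := exists_nonzero_zero (M := Module.finrank ℝ U)
    (ι := Fin (Module.finrank ℝ W)) (by simpa using hd)
    (fun k => ∑ i, ∑ j, C ((b.repr (B (e i) (e j)) k : ℝ) : ℂ) * X i * X j) (by intro i; simp)
  refine ⟨∑ i, (ξ i).re • e i, ∑ i, (ξ i).im • e i, ?_, ?_, ?_⟩
  · by_contra h
    push Not at h
    apply hξ
    ext i
    apply Complex.ext
    · simpa using Fintype.linearIndependent_iff.1 e.linearIndependent _ h.1 i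
    · simpa using Fintype.linearIndependent_iff.1 e.linearIndependent _ h.2 i
  · apply b.repr.injective
    ext k
    have := congrArg Complex.re (hzero k)
    simp only [map_sum, map_mul, eval_C, eval_X, Complex.re_sum, Complex.mul_re, Complex.ofReal_re,
      Complex.ofReal_im, Complex.mul_im] at this
    simp only [map_sum, map_smul, LinearMap.sum_apply, LinearMap.smul_apply, Finsupp.coe_finsetSum,
      Finset.sum_apply, Finsupp.coe_smul, Pi.smul_apply, smul_eq_mul]
    simp only [Finset.mul_sum]
    rw [← sub_eq_zero, ← Finset.sum_sub_distrib]
    simp only [← Finset.sum_sub_distrib]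
    simp only [zero_mul, sub_zero, add_zero, Complex.zero_re] at this
    rw [← this, Finset.sum_comm]
    refine Finset.sum_congr rfl fun i _ => Finset.sum_congr rfl fun j _ => ?_
    ring
  · apply b.repr.injective
    ext k
    have := congrArg Complex.im (hzero k)
    simp only [map_sum, map_mul, eval_C, eval_X, Complex.im_sum, Complex.mul_re, Complex.ofReal_re,
      Complex.ofReal_im, Complex.mul_im] at this
    simp only [map_sum, map_smul, LinearMap.sum_apply, LinearMap.smul_apply, Finsupp.coe_finsetSum,
      Finset.sum_apply, Finsupp.coe_smul, Pi.smul_apply, smul_eq_mul, map_zero, Finsupp.coe_zero,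
      Pi.zero_apply]
    simp only [zero_mul, sub_zero, add_zero, Complex.zero_im, Finset.sum_add_distrib] at this
    have h2 : ∑ x, ∑ y, (b.repr (B (e x) (e y)) k) * (ξ x).re * (ξ y).im =
       ∑ x, ∑ y, (b.repr (B (e x) (e y)) k) * (ξ x).im * (ξ y).re := by
      rw [Finset.sum_comm]
      refine Finset.sum_congr rfl fun i _ => Finset.sum_congr rfl fun j _ => ?_
      rw [hB]; ring
    have h3 : ∑ x, ∑ y, (b.repr (B (e x) (e y)) k) * (ξ x).re * (ξ y).im = 0 := by linarith
    simp only [Finset.mul_sum]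
    rw [← h3, Finset.sum_comm]
    refine Finset.sum_congr rfl fun i _ => Finset.sum_congr rfl fun j _ => ?_
    ring


section tsen
open Polynomial in
lemma exists_degBound {A : Type*} [CommRing A] [Algebra ℝ A] [Algebra ℝ[X] A]
    [IsScalarTower ℝ ℝ[X] A] {r : ℕ} (w : Module.Basis (Fin r) ℝ[X] A) (c : A) :
    ∃ k : ℕ, ∀ k' ≥ k, ∀ d d' : ℕ, ∀ u v : A, (∀ i, w.repr u i ∈ degreeLT ℝ d) →
      (∀ i, w.repr v i ∈ degreeLT ℝ d') → ∀ l, w.repr (c * u * v) l ∈ degreeLT ℝ (d + d' + k') := by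
  refine ⟨∑ i, ∑ j, ∑ l, ((w.repr (c * w i * w j) l).natDegree + 1), ?_⟩
  intro k' hk' d d' u v hu hv l
  have key : w.repr (c * u * v) l =
      ∑ i, ∑ j, w.repr u i * w.repr v j * w.repr (c * w i * w j) l := by
    conv_lhs => rw [← w.sum_repr u, ← w.sum_repr v]
    rw [Finset.mul_sum (f := fun i => w.repr u i • w i), Finset.sum_mul_sum, map_sum]
    simp only [map_sum, Finsupp.coe_finsetSum, Finset.sum_apply]
    refine Finset.sum_congr rfl fun i _ => Finset.sum_congr rfl fun j _ => ?_
    have : c * w.repr u i • w i * w.repr v j • w j =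
      (w.repr u i * w.repr v j) • (c * w i * w j) := by
      simp only [Algebra.smul_def, map_mul]; ring
    rw [this, map_smul]
    simp
  rw [key]
  refine Submodule.sum_mem _ fun i _ => Submodule.sum_mem _ fun j _ => ?_
  have h1 : (w.repr (c * w i * w j) l).natDegree + 1 ≤ k' := by
    refine le_trans ?_ hk'
    refine le_trans ?_ (Finset.single_le_sum (f := fun i => ∑ j, ∑ l, ((w.repr (c * w i * w j) l).natDegree + 1)) (fun _ _ => Nat.zero_le _) (Finset.mem_univ i))
    refine le_trans ?_ (Finset.single_le_sum (f := fun j => ∑ l, ((w.repr (c * w i * w j) l).natDegree + 1)) (fun _ _ => Nat.zero_le _) (Finset.mem_univ j))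
    exact (Finset.single_le_sum (f := fun l => ((w.repr (c * w i * w j) l).natDegree + 1)) (fun _ _ => Nat.zero_le _) (Finset.mem_univ l))
  have hu' := hu i
  have hv' := hv j
  generalize w.repr u i = x at *
  generalize w.repr v j = y at *
  generalize w.repr (c * w i * w j) l = z at *
  by_cases hx : x = 0
  · simp [hx]
  by_cases hy : y = 0
  · simp [hy]
  by_cases hz : z = 0
  · simp [hz]
  rw [mem_degreeLT, ← natDegree_lt_iff_degree_lt (by assumption)] at hu' hv'
  rw [mem_degreeLT, ← natDegree_lt_iff_degree_lt (by simp [hx, hy, hz])]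
  rw [natDegree_mul (by simp [hx, hy]) hz, natDegree_mul hx hy]
  omega

open Polynomial in
lemma tsen {A : Type*} [CommRing A] [IsDomain A] [Algebra ℝ A] [Algebra ℝ[X] A]
    [IsScalarTower ℝ ℝ[X] A] [Module.Finite ℝ[X] A] [Module.IsTorsionFree ℝ[X] A] (a b : A) :
    ∃ x1 y1 z1 x2 y2 z2 : A, ¬ (x1 = 0 ∧ y1 = 0 ∧ z1 = 0 ∧ x2 = 0 ∧ y2 = 0 ∧ z2 = 0) ∧
      x1 * x1 + a * y1 * y1 + b * z1 * z1 = x2 * x2 + a * y2 * y2 + b * z2 * z2 ∧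
      x1 * x2 + a * y1 * y2 + b * z1 * z2 = 0 := by
  set w := Module.finBasis ℝ[X] A with hw
  set r := Module.finrank ℝ[X] A with hr
  have hrpos : 0 < r := Module.finrank_pos
  let E : ℕ → Submodule ℝ A := fun d =>
    { carrier := {u | ∀ i, w.repr u i ∈ degreeLT ℝ d}
      add_mem' := fun {u v} hu hv i => by
        rw [map_add]; exact Submodule.add_mem _ (hu i) (hv i)
      zero_mem' := fun i => by simp
      smul_mem' := fun c u hu i => by
        have : c • u = (Polynomial.C c : ℝ[X]) • u := by
          rw [← Polynomial.algebraMap_eq, algebraMap_smul]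
        rw [this, map_smul]
        have h2 : (Polynomial.C c • w.repr u) i = c • (w.repr u i) := by
          simp [Polynomial.smul_eq_C_mul]
        rw [h2]
        exact Submodule.smul_mem _ _ (hu i) }
  have hE : ∀ d u, u ∈ E d ↔ ∀ i, w.repr u i ∈ degreeLT ℝ d := fun d u => Iff.rfl
  let eqv : ∀ d, E d ≃ₗ[ℝ] (Fin r → degreeLT ℝ d) := fun d =>
    LinearEquiv.ofBijective
      { toFun := fun u i => ⟨w.repr u.1 i, u.2 i⟩
        map_add' := fun u v => by ext; simp
        map_smul' := fun c u => by
          funext i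
          apply Subtype.ext
          have : c • u.1 = (Polynomial.C c : ℝ[X]) • u.1 := by
            rw [← Polynomial.algebraMap_eq, algebraMap_smul]
          simp [this, Polynomial.smul_eq_C_mul] }
      (by
        constructor
        · intro u v huv
          apply Subtype.ext
          apply w.repr.injective
          ext1 i
          exact congrArg Subtype.val (congrFun huv i)
        · intro f
          refine ⟨⟨∑ i, (f i).1 • w i, ?_⟩, ?_⟩
          · intro i
            rw [w.repr_sum_self]
            exact (f i).2
          · funext i
            apply Subtype.ext
            exact congrFun (w.repr_sum_self (fun i => (f i).1)) i)
  have hfd : ∀ d, FiniteDimensional ℝ (E d) := fun d =>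
    haveI : FiniteDimensional ℝ (degreeLT ℝ d) :=
      Module.Finite.equiv (degreeLTEquiv ℝ d).symm
    Module.Finite.equiv (eqv d).symm
  have hfr : ∀ d, Module.finrank ℝ (E d) = r * d := fun d => by
    rw [(eqv d).finrank_eq, Module.finrank_pi_fintype, (degreeLTEquiv ℝ d).finrank_eq]
    simp
  obtain ⟨k1, hk1⟩ := exists_degBound w (1 : A)
  obtain ⟨k2, hk2⟩ := exists_degBound w a
  obtain ⟨k3, hk3⟩ := exists_degBound w b
  set k := k1 + k2 + k3 with hk
  set d := k + 1 with hd
  have hmem : ∀ u v : E d × E d × E d, (u.1.1 * v.1.1 + a * u.2.1.1 * v.2.1.1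
      + b * u.2.2.1 * v.2.2.1) ∈ E (d + d + k) := by
    intro u v
    refine Submodule.add_mem _ (Submodule.add_mem _ ?_ ?_) ?_
    · have := hk1 k (by omega) d d u.1.1 v.1.1 u.1.2 v.1.2
      rw [one_mul] at this
      exact this
    · exact hk2 k (by omega) d d u.2.1.1 v.2.1.1 u.2.1.2 v.2.1.2
    · exact hk3 k (by omega) d d u.2.2.1 v.2.2.1 u.2.2.2 v.2.2.2
  let B : (E d × E d × E d) →ₗ[ℝ] (E d × E d × E d) →ₗ[ℝ] E (d + d + k) :=
    LinearMap.mk₂ ℝ (fun u v => ⟨_, hmem u v⟩)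
      (fun u u' v => by apply Subtype.ext; simp; ring)
      (fun c u v => by apply Subtype.ext; simp [smul_add])
      (fun u v v' => by apply Subtype.ext; simp; ring)
      (fun c u v => by apply Subtype.ext; simp [smul_add])
  obtain ⟨v1, v2, hne, h1, h2⟩ := exists_bilin B
    (fun u v => by apply Subtype.ext; simp [B]; ring)
    (by
      rw [Module.finrank_prod, Module.finrank_prod, hfr, hfr]
      have : d + d + k < 3 * d := by omega
      nlinarith)
  refine ⟨v1.1.1, v1.2.1.1, v1.2.2.1, v2.1.1, v2.2.1.1, v2.2.2.1, ?_, ?_, ?_⟩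
  · rintro ⟨e1, e2, e3, e4, e5, e6⟩
    rcases hne with h | h <;> apply h
    · ext <;> assumption
    · ext <;> assumption
  · exact congrArg Subtype.val h1
  · exact congrArg Subtype.val h2

open Polynomial in
/-- the quaternary form `<1,a,b,-ab>` is isotropic -/
lemma isotropic {A : Type*} [CommRing A] [IsDomain A] [Algebra ℝ A] [Algebra ℝ[X] A]
    [IsScalarTower ℝ ℝ[X] A] [Module.Finite ℝ[X] A] [Module.IsTorsionFree ℝ[X] A] (a b : A) :
    ∃ x y z w : A, ¬ (x = 0 ∧ y = 0 ∧ z = 0 ∧ w = 0) ∧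
      x ^ 2 + a * y ^ 2 + b * z ^ 2 = a * b * w ^ 2 := by
  obtain ⟨x1, y1, z1, x2, y2, z2, hne, h1, h2⟩ := tsen a b
  by_cases hc : x1 * x1 + a * y1 * y1 + b * z1 * z1 = 0
  · by_cases h : x1 = 0 ∧ y1 = 0 ∧ z1 = 0
    · refine ⟨x2, y2, z2, 0, ?_, ?_⟩
      · tauto
      · rw [h1] at hc; linear_combination hc
    · refine ⟨x1, y1, z1, 0, ?_, ?_⟩
      · tauto
      · linear_combination hc
  · refine ⟨a * b * (y1 * z2 - y2 * z1), b * (z1 * x2 - z2 * x1), a * (x1 * y2 - x2 * y1),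
      x1 * x1 + a * y1 * y1 + b * z1 * z1, by tauto, ?_⟩
    linear_combination (-(a * b * (x1 * x1 + a * y1 * y1 + b * z1 * z1))) * h1
      - a * b * (x1 * x2 + a * y1 * y2 + b * z1 * z2) * h2
end tsen


open scoped Polynomial

/-- points of a real algebraic set as evaluations of its coordinate ring -/
structure PD {n : ℕ} (S : Set (Fin n → ℝ)) (A : Type*) [CommRing A] [Algebra ℝ A] where
  π : MvPolynomial (Fin n) ℝ →ₐ[ℝ] A
  surj : Function.Surjective π
  ev : S → A →ₐ[ℝ] ℝ
  ev_π : ∀ x p, ev x (π p) = eval x.1 p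
  lift : ∀ φ : A →ₐ[ℝ] ℝ, (fun i => φ (π (MvPolynomial.X i))) ∈ S

section curve
set_option linter.unusedSectionVars false
variable {n : ℕ} {S : Set (Fin n → ℝ)} {A : Type*} [CommRing A] [Algebra ℝ A]

lemma PD.continuous_ev (D : PD S A) (a : A) : Continuous fun x : S => D.ev x a := by
  obtain ⟨p, rfl⟩ := D.surj a
  simp only [D.ev_π]
  exact (MvPolynomial.continuous_eval p).comp continuous_subtype_val

variable [Algebra ℝ[X] A]

/-- the projection to the line -/
noncomputable def PD.τ (D : PD S A) (x : S) : ℝ := D.ev x (algebraMap ℝ[X] A Polynomial.X)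

lemma PD.continuous_τ (D : PD S A) : Continuous D.τ := D.continuous_ev _

variable [IsScalarTower ℝ ℝ[X] A]

lemma PD.ev_algebraMap (D : PD S A) (x : S) (q : ℝ[X]) :
    D.ev x (algebraMap ℝ[X] A q) = q.eval (D.τ x) := by
  have h : ((D.ev x).comp (IsScalarTower.toAlgHom ℝ ℝ[X] A)) = Polynomial.aeval (D.τ x) := by
    apply Polynomial.algHom_ext
    simp [PD.τ]
  have := DFunLike.congr_fun h q
  simpa [Polynomial.aeval_def] using this

lemma PD.ev_aeval (D : PD S A) (x : S) (a : A) (P : ℝ[X][X]) :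
    D.ev x (Polynomial.aeval a P) =
      (P.map (Polynomial.evalRingHom (D.τ x))).eval (D.ev x a) := by
  rw [Polynomial.eval_map, Polynomial.aeval_def]
  change (D.ev x : A →+* ℝ) _ = _
  rw [Polynomial.hom_eval₂]
  congr 1
  exact RingHom.ext fun q => D.ev_algebraMap x q

variable [Module.Finite ℝ[X] A]

lemma PD.root (D : PD S A) (a : A) : ∃ P : ℝ[X][X], P.Monic ∧ ∀ x,
    (P.map (Polynomial.evalRingHom (D.τ x))).IsRoot (D.ev x a) := by
  obtain ⟨P, hP, h⟩ := Algebra.IsIntegral.isIntegral (R := ℝ[X]) a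
  refine ⟨P, hP, fun x => ?_⟩
  rw [Polynomial.IsRoot, ← D.ev_aeval, Polynomial.aeval_def, h, map_zero]

lemma PD.fiber_finite (D : PD S A) (c : ℝ) : {x : S | D.τ x = c}.Finite := by
  choose P hP hroot using fun i : Fin n => D.root (D.π (MvPolynomial.X i))
  have hfin : (Set.pi Set.univ (fun i : Fin n =>
      {y : ℝ | ((P i).map (Polynomial.evalRingHom c)).IsRoot y})).Finite := by
    refine Set.Finite.pi fun i => ?_
    exact Polynomial.finite_setOfPred_isRoot (((hP i).map _).ne_zero)
  refine Set.Finite.of_finite_image (f := Subtype.val) (hfin.subset ?_)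
    Subtype.val_injective.injOn
  rintro _ ⟨x, hx, rfl⟩ i _
  have := hroot i x
  rw [D.ev_π, eval_X] at this
  simp only [Set.mem_ofPred_eq] at hx ⊢
  rwa [hx] at this

lemma PD.exists_norm [IsDomain A] (_D : PD S A) {a : A} (ha : a ≠ 0) :
    ∃ (N : ℝ[X]) (a' : A), N ≠ 0 ∧ a * a' = algebraMap ℝ[X] A N := by
  have h := Ideal.comap_ne_bot_of_integral_mem (R := ℝ[X]) (I := Ideal.span {a}) ha
    (Ideal.mem_span_singleton_self a) (Algebra.IsIntegral.isIntegral a)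
  obtain ⟨N, hN, hN0⟩ := Submodule.exists_mem_ne_zero_of_ne_bot h
  rw [Ideal.mem_comap, Ideal.mem_span_singleton] at hN
  obtain ⟨a', h'⟩ := hN
  exact ⟨N, a', hN0, h'.symm⟩

lemma PD.zeros_finite [IsDomain A] (D : PD S A) {a : A} (ha : a ≠ 0) :
    {x : S | D.ev x a = 0}.Finite := by
  obtain ⟨N, a', hN, h⟩ := D.exists_norm ha
  have hfin : (⋃ c ∈ {y : ℝ | N.IsRoot y}, {x : S | D.τ x = c}).Finite :=
    (Polynomial.finite_setOfPred_isRoot hN).biUnion fun c _ => D.fiber_finite c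
  refine hfin.subset fun x hx => ?_
  simp only [Set.mem_iUnion, Set.mem_ofPred_eq] at hx ⊢
  refine ⟨D.τ x, ?_, rfl⟩
  rw [Polynomial.IsRoot, ← D.ev_algebraMap, ← h, map_mul, hx, zero_mul]

lemma PD.closed (D : PD S A) : IsClosed S := by
  have : S = {x | ∀ p ∈ RingHom.ker D.π, eval x p = 0} := by
    ext x
    constructor
    · intro hx p hp
      rw [RingHom.mem_ker] at hp
      have := D.ev_π ⟨x, hx⟩ p
      rw [hp, map_zero] at this
      exact this.symm
    · intro hx
      let φ : A →ₐ[ℝ] ℝ := (Ideal.Quotient.liftₐ (RingHom.ker D.π) (MvPolynomial.aeval x)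
        (fun p hp => by simpa [aeval_eq_eval] using hx p hp)).comp
        (Ideal.quotientKerAlgEquivOfSurjective D.surj).symm.toAlgHom
      have h := D.lift φ
      convert h using 1
      ext i
      have : (Ideal.quotientKerAlgEquivOfSurjective D.surj).symm (D.π (MvPolynomial.X i)) =
        Ideal.Quotient.mk _ (MvPolynomial.X i) := by
        rw [AlgEquiv.symm_apply_eq]
        rfl
      simp only [φ, AlgHom.comp_apply]
      change x i = (Ideal.Quotient.liftₐ (RingHom.ker D.π) (MvPolynomial.aeval x) _)
        ((Ideal.quotientKerAlgEquivOfSurjective D.surj).symm (D.π (MvPolynomial.X i)))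
      rw [this]
      simp
  rw [this]
  simp only [Set.ofPred_forall]
  exact isClosed_iInter fun p => isClosed_iInter fun _ =>
    isClosed_eq (MvPolynomial.continuous_eval p) continuous_const

lemma monic_bound (P : ℝ[X][X]) (hP : P.Monic) (T : ℝ) : ∃ M : ℝ, ∀ c, |c| ≤ T → ∀ y : ℝ,
    (P.map (Polynomial.evalRingHom c)).IsRoot y → |y| ≤ M := by
  have hb : ∀ i, ∃ M : ℝ, 0 ≤ M ∧ ∀ c, |c| ≤ T → |(P.coeff i).eval c| ≤ M := by
    intro i
    obtain ⟨M, hM⟩ := (isCompact_Icc (a := -T) (b := T)).exists_bound_of_continuousOn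
      (f := fun c => (P.coeff i).eval c) (by fun_prop)
    refine ⟨max M 0, le_max_right _ _, fun c hc => le_trans ?_ (le_max_left _ _)⟩
    exact hM c (abs_le.1 hc)
  choose M hM0 hM using hb
  refine ⟨∑ i ∈ Finset.range P.natDegree, M i + 1, fun c hc y hy => ?_⟩
  have hmon := hP.map (Polynomial.evalRingHom c)
  have h := Polynomial.IsRoot.norm_lt_cauchyBound hmon.ne_zero hy
  have h2 : ((P.map (Polynomial.evalRingHom c)).cauchyBound : ℝ) ≤
      ∑ i ∈ Finset.range P.natDegree, M i + 1 := by
    rw [Polynomial.cauchyBound, hmon.leadingCoeff, hP.natDegree_map]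
    simp only [nnnorm_one, div_one, NNReal.coe_add, NNReal.coe_one, add_le_add_iff_right]
    have h3 : (Finset.range P.natDegree).sup
        (fun i => ‖(P.map (Polynomial.evalRingHom c)).coeff i‖₊) ≤
        Real.toNNReal (∑ i ∈ Finset.range P.natDegree, M i) := by
      apply Finset.sup_le
      intro i hi
      rw [← NNReal.coe_le_coe, Real.coe_toNNReal _ (Finset.sum_nonneg fun i _ => hM0 i)]
      simp only [Polynomial.coeff_map, Polynomial.coe_evalRingHom, coe_nnnorm, Real.norm_eq_abs]
      exact (hM i c hc).trans (Finset.single_le_sum (fun i _ => hM0 i) hi)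
    have h4 := NNReal.coe_le_coe.2 h3
    rwa [Real.coe_toNNReal _ (Finset.sum_nonneg fun i _ => hM0 i)] at h4
  have h5 : |y| < ((P.map (Polynomial.evalRingHom c)).cauchyBound : ℝ) := by
    have := NNReal.coe_lt_coe.2 h
    simpa using this
  linarith

lemma PD.compact (D : PD S A) (T : ℝ) : IsCompact {x : S | |D.τ x| ≤ T} := by
  choose P hP hroot using fun i : Fin n => D.root (D.π (MvPolynomial.X i))
  choose M hM using fun i => monic_bound (P i) (hP i) T
  have h1 : IsCompact (Set.pi Set.univ fun i : Fin n => Set.Icc (-M i) (M i)) :=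
    isCompact_univ_pi fun i => isCompact_Icc
  have h2 := (D.closed.isClosedEmbedding_subtypeVal).isCompact_preimage h1
  refine h2.of_isClosed_subset ?_ ?_
  · exact isClosed_le (D.continuous_τ.abs) continuous_const
  · intro x hx i _
    have := hM i (D.τ x) hx _ (hroot i x)
    rw [D.ev_π, eval_X] at this
    exact abs_le.1 this

lemma PD.isClosed_image (D : PD S A) {K : Set S} (hK : IsClosed K) : IsClosed (D.τ '' K) := by
  rw [← isSeqClosed_iff_isClosed]
  intro u a hu hua
  obtain ⟨T, hT⟩ := (Metric.isBounded_range_of_tendsto u hua).exists_norm_le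
  have hcomp : IsCompact (D.τ '' (K ∩ {x : S | |D.τ x| ≤ T})) :=
    ((D.compact T).inter_left hK).image D.continuous_τ
  have : a ∈ D.τ '' (K ∩ {x : S | |D.τ x| ≤ T}) := by
    refine hcomp.isClosed.mem_of_tendsto hua (Filter.Eventually.of_forall fun k => ?_)
    obtain ⟨x, hx, hxk⟩ := hu k
    refine ⟨x, ⟨hx, ?_⟩, hxk⟩
    have := hT (u k) ⟨k, rfl⟩
    simp only [Set.mem_ofPred_eq]
    rw [hxk]; exact this
  obtain ⟨x, hx, h⟩ := this
  exact ⟨x, hx.1, h⟩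
end curve


lemma prim_elt {A : Type*} [CommRing A] [IsDomain A] [Algebra ℝ[X] A]
    [Module.Finite ℝ[X] A] [Module.IsTorsionFree ℝ[X] A] :
    ∃ (y : A) (d : ℝ[X]), d ≠ 0 ∧ ∀ a : A, ∃ Q : ℝ[X][X],
      Polynomial.aeval y Q = algebraMap ℝ[X] A d * a := by
  classical
  let K := FractionRing ℝ[X]
  let L := FractionRing A
  let : Algebra K L := FractionRing.liftAlgebra ℝ[X] L
  have : IsScalarTower ℝ[X] K L := inferInstance
  have hfd : Module.Finite K L := Module.Finite.of_isLocalization ℝ[X] A (nonZeroDivisors ℝ[X])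
  have : CharZero K := charZero_of_injective_algebraMap (IsFractionRing.injective ℝ[X] K)
  obtain ⟨θ, hθ⟩ := Field.exists_primitive_element K L
  have hinjA : Function.Injective (algebraMap ℝ[X] A) := FaithfulSMul.algebraMap_injective _ _
  have hinj : Function.Injective (algebraMap A L) := IsFractionRing.injective A L
  -- scale
  obtain ⟨⟨y, s⟩, hs⟩ := IsLocalization.surj
    (Algebra.algebraMapSubmonoid A (nonZeroDivisors ℝ[X])) θ
  obtain ⟨_, c, hc, rfl⟩ := s
  have hc0 : c ≠ 0 := nonZeroDivisors.ne_zero hc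
  simp only at hs
  have hcL : algebraMap A L (algebraMap ℝ[X] A c) = algebraMap K L (algebraMap ℝ[X] K c) := by
    rw [← IsScalarTower.algebraMap_apply, ← IsScalarTower.algebraMap_apply]
  have hcK : algebraMap ℝ[X] K c ≠ 0 := by
    rwa [Ne, map_eq_zero_iff _ (IsFractionRing.injective ℝ[X] K)]
  -- every element is a polynomial in y over K
  have hpol : ∀ z : L, ∃ q : K[X], Polynomial.aeval (algebraMap A L y) q = z := by
    intro z
    have hz : z ∈ Algebra.adjoin K {θ} := by
      rw [← IntermediateField.adjoin_simple_toSubalgebra_of_isAlgebraic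
        (Algebra.IsAlgebraic.isAlgebraic θ), hθ]
      trivial
    rw [Algebra.adjoin_singleton_eq_range_aeval] at hz
    obtain ⟨q, rfl⟩ := hz
    refine ⟨q.comp (Polynomial.C (algebraMap ℝ[X] K c)⁻¹ * Polynomial.X), ?_⟩
    rw [Polynomial.aeval_comp]
    congr 1
    simp only [map_mul, Polynomial.aeval_C, Polynomial.aeval_X]
    rw [← hs, hcL, map_inv₀]
    have : algebraMap K L (algebraMap ℝ[X] K c) ≠ 0 := by
      simpa using hcK
    rw [mul_comm θ, ← mul_assoc, inv_mul_cancel₀ this, one_mul]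
  -- clear denominators
  have hone : ∀ a : A, ∃ (d : ℝ[X]) (Q : ℝ[X][X]), d ≠ 0 ∧
      Polynomial.aeval y Q = algebraMap ℝ[X] A d * a := by
    intro a
    obtain ⟨q, hq⟩ := hpol (algebraMap A L a)
    obtain ⟨b, hbm, hb⟩ := IsLocalization.integerNormalization_spec (nonZeroDivisors ℝ[X]) q
    refine ⟨b, IsLocalization.integerNormalization (nonZeroDivisors ℝ[X]) q,
      nonZeroDivisors.ne_zero hbm, ?_⟩
    apply hinj
    rw [← Polynomial.aeval_algebraMap_apply, ← Polynomial.aeval_map_algebraMap K, hb, map_mul]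
    rw [← hq, ← algebraMap_smul K b q, map_smul, Algebra.smul_def,
      ← IsScalarTower.algebraMap_apply, ← IsScalarTower.algebraMap_apply]
  obtain ⟨T, hT⟩ := Module.Finite.fg_top (R := ℝ[X]) (M := A)
  choose d Q hd hQ using hone
  refine ⟨y, ∏ a ∈ T, d a, Finset.prod_ne_zero_iff.2 fun a _ => hd a, fun a => ?_⟩
  have ha : a ∈ Submodule.span ℝ[X] (T : Set A) := by rw [hT]; trivial
  induction ha using Submodule.span_induction with
  | mem x hx =>
    refine ⟨Polynomial.C (∏ a ∈ T.erase x, d a) * Q x, ?_⟩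
    rw [map_mul, Polynomial.aeval_C, hQ, ← mul_assoc, ← map_mul, Finset.prod_erase_mul _ _ hx]
  | zero => exact ⟨0, by simp⟩
  | add u v _ _ hu hv =>
    obtain ⟨U, hU⟩ := hu
    obtain ⟨V, hV⟩ := hv
    exact ⟨U + V, by rw [map_add, hU, hV, mul_add]⟩
  | smul r u _ hu =>
    obtain ⟨U, hU⟩ := hu
    exact ⟨Polynomial.C r * U, by rw [map_mul, hU, Polynomial.aeval_C, Algebra.smul_def]; ring⟩


lemma sign_change (q : ℝ[X]) (y0 : ℝ) (h0 : q.eval y0 = 0) (h1 : q.derivative.eval y0 ≠ 0)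
    (ε : ℝ) (hε : 0 < ε) : ∃ y1 y2, y0 - ε < y1 ∧ y1 < y0 ∧ y0 < y2 ∧ y2 < y0 + ε ∧
      q.eval y1 * q.eval y2 < 0 := by
  obtain ⟨r, rfl⟩ := Polynomial.dvd_iff_isRoot.2 h0
  have hr : r.eval y0 ≠ 0 := by simpa using h1
  have hc : ContinuousAt (fun y => r.eval y * r.eval y0) y0 := by fun_prop
  have hpos : ∀ᶠ y in nhds y0, 0 < r.eval y * r.eval y0 :=
    hc.eventually (lt_mem_nhds (mul_self_pos.2 hr))
  obtain ⟨δ, hδ, hball⟩ := Metric.eventually_nhds_iff.1 hpos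
  set e := min (δ / 2) (ε / 2) with he
  have he0 : 0 < e := by positivity
  have he1 : e ≤ δ / 2 := min_le_left _ _
  have he2 : e ≤ ε / 2 := min_le_right _ _
  have ha := @hball (y0 - e) (by rw [Real.dist_eq, abs_lt]; constructor <;> linarith)
  have hb := @hball (y0 + e) (by rw [Real.dist_eq, abs_lt]; constructor <;> linarith)
  refine ⟨y0 - e, y0 + e, by linarith, by linarith, by linarith, by linarith, ?_⟩
  have hab : 0 < r.eval (y0 - e) * r.eval (y0 + e) := by
    have := mul_pos ha hb
    have h3 : 0 < r.eval y0 ^ 2 := by positivity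
    nlinarith
  simp only [Polynomial.eval_mul, Polynomial.eval_sub, Polynomial.eval_X, Polynomial.eval_C]
  have := mul_pos (mul_pos he0 he0) hab
  nlinarith

lemma thom_aux (k : ℕ) : ∀ q : ℝ[X], q.natDegree ≤ k → ∀ a b : ℝ, a ≤ b →
    (∀ j ≤ k, 0 < (Polynomial.derivative^[j] q).eval a * (Polynomial.derivative^[j] q).eval b ∨
      q.natDegree < j) →
    ∀ z ∈ Set.Icc a b, 0 < q.eval a * q.eval z := by
  induction k with
  | zero =>
    intro q hq a b hab h z hz
    have h0 := h 0 le_rfl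
    obtain ⟨c, rfl⟩ : ∃ c, q = Polynomial.C c :=
      ⟨_, Polynomial.eq_C_of_natDegree_eq_zero (Nat.le_zero.1 hq)⟩
    simpa using h0
  | succ k ih =>
    intro q hq a b hab h z hz
    have h0 : 0 < q.eval a * q.eval b := by simpa using h 0 (Nat.zero_le _)
    rcases Nat.eq_zero_or_pos q.natDegree with hd0 | hd0
    · obtain ⟨c, rfl⟩ : ∃ c, q = Polynomial.C c := ⟨_, Polynomial.eq_C_of_natDegree_eq_zero hd0⟩
      simpa using h0
    have hq' : q.derivative.natDegree ≤ k :=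
      (Polynomial.natDegree_derivative_le q).trans (by omega)
    have hD := ih q.derivative hq' a b hab (fun j hj => by
      rcases h (j+1) (by omega) with h | h
      · left; simpa using h
      · right
        exact lt_of_le_of_lt (Polynomial.natDegree_derivative_le q) (by omega))
    have hda : q.derivative.eval a ≠ 0 := by
      intro h0
      have := hD a ⟨le_rfl, hab⟩
      simp [h0] at this
    have hmem : ∀ y ∈ interior (Set.Icc a b), y ∈ Set.Icc a b := fun y hy => interior_subset hy
    rcases lt_or_gt_of_ne hda with hneg | hpos
    · have hm : AntitoneOn (fun y => q.eval y) (Set.Icc a b) := by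
        refine antitoneOn_of_deriv_nonpos (convex_Icc a b) (by fun_prop) (by fun_prop) ?_
        intro y hy
        have := hD y (hmem y hy)
        rw [Polynomial.deriv]
        nlinarith
      have h1 : q.eval z ≤ q.eval a := hm ⟨le_rfl, hab⟩ hz hz.1
      have h2 : q.eval b ≤ q.eval z := hm hz ⟨hab, le_rfl⟩ hz.2
      rcases pos_and_pos_or_neg_and_neg_of_mul_pos h0 with ⟨h3, h4⟩ | ⟨h3, h4⟩
      · exact mul_pos h3 (by linarith)
      · exact mul_pos_of_neg_of_neg h3 (by linarith)
    · have hm : MonotoneOn (fun y => q.eval y) (Set.Icc a b) := by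
        refine monotoneOn_of_deriv_nonneg (convex_Icc a b) (by fun_prop) (by fun_prop) ?_
        intro y hy
        have := hD y (hmem y hy)
        rw [Polynomial.deriv]
        nlinarith
      have h1 : q.eval a ≤ q.eval z := hm ⟨le_rfl, hab⟩ hz hz.1
      have h2 : q.eval z ≤ q.eval b := hm hz ⟨hab, le_rfl⟩ hz.2
      rcases pos_and_pos_or_neg_and_neg_of_mul_pos h0 with ⟨h3, h4⟩ | ⟨h3, h4⟩
      · exact mul_pos h3 (by linarith)
      · exact mul_pos_of_neg_of_neg h3 (by linarith)

lemma thom_lt (q : ℝ[X]) (a b : ℝ) (ha : q.eval a = 0) (hb : q.eval b = 0)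
    (h : ∀ j, 1 ≤ j → j ≤ q.natDegree →
      0 < (Polynomial.derivative^[j] q).eval a * (Polynomial.derivative^[j] q).eval b)
    (hd : 0 < q.natDegree) : ¬ a < b := by
  intro hab
  have hD := thom_aux (q.natDegree - 1) q.derivative (Polynomial.natDegree_derivative_le q) a b
    hab.le (fun j hj => Or.inl (by simpa using h (j+1) (by omega) (by omega)))
  obtain ⟨c, hc, hc0⟩ := exists_deriv_eq_zero (f := fun y => q.eval y) hab (by fun_prop)
    (by rw [ha, hb])
  rw [Polynomial.deriv] at hc0
  have := hD c ⟨hc.1.le, hc.2.le⟩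
  simp [hc0] at this

lemma thom (q : ℝ[X]) (a b : ℝ) (ha : q.eval a = 0) (hb : q.eval b = 0)
    (h : ∀ j, 1 ≤ j → j ≤ q.natDegree →
      0 < (Polynomial.derivative^[j] q).eval a * (Polynomial.derivative^[j] q).eval b)
    (hd : 0 < q.natDegree) : a = b :=
  le_antisymm (not_lt.1 (thom_lt q b a hb ha (fun j h1 h2 => by rw [mul_comm]; exact h j h1 h2) hd))
    (not_lt.1 (thom_lt q a b ha hb h hd))

section curve2
set_option linter.unusedSectionVars false
variable {n : ℕ} {S : Set (Fin n → ℝ)} {A : Type*} [CommRing A] [Algebra ℝ A]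
  [Algebra ℝ[X] A] [IsScalarTower ℝ ℝ[X] A] [Module.Finite ℝ[X] A] [IsDomain A]
  [Module.IsTorsionFree ℝ[X] A]

lemma PD.ev_injective (D : PD S A) {x x' : S} (h : ∀ a, D.ev x a = D.ev x' a) : x = x' := by
  ext i
  have := h (D.π (MvPolynomial.X i))
  simpa [D.ev_π] using this

lemma PD.inj_of_prim (D : PD S A) {y : A} {d : ℝ[X]}
    (hQ : ∀ a : A, ∃ Q : ℝ[X][X], Polynomial.aeval y Q = algebraMap ℝ[X] A d * a) {x x' : S}
    (hd : d.eval (D.τ x) ≠ 0) (ht : D.τ x = D.τ x') (hy : D.ev x y = D.ev x' y) : x = x' := by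
  refine D.ev_injective fun a => ?_
  obtain ⟨Q, h⟩ := hQ a
  have h1 := congrArg (D.ev x) h
  have h2 := congrArg (D.ev x') h
  rw [D.ev_aeval, map_mul, D.ev_algebraMap] at h1 h2
  rw [ht, hy, h2] at h1
  rw [ht] at hd
  exact (mul_left_cancel₀ hd h1).symm

lemma PD.lift_of_prim (D : PD S A) {y : A} {d : ℝ[X]}
    (hQ : ∀ a : A, ∃ Q : ℝ[X][X], Polynomial.aeval y Q = algebraMap ℝ[X] A d * a)
    {t0 y0 : ℝ} (hd : d.eval t0 ≠ 0)
    (hr : (minpoly ℝ[X] y).evalEval t0 y0 = 0) : ∃ x : S, D.τ x = t0 ∧ D.ev x y = y0 := by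
  choose Q hQ using hQ
  have hint : IsIntegral ℝ[X] y := Algebra.IsIntegral.isIntegral y
  have key : ∀ U V : ℝ[X][X], Polynomial.aeval y U = Polynomial.aeval y V →
      U.evalEval t0 y0 = V.evalEval t0 y0 := by
    intro U V h
    have h1 : Polynomial.aeval y (U - V) = 0 := by rw [map_sub, h, sub_self]
    obtain ⟨W, hW⟩ := minpoly.isIntegrallyClosed_dvd hint h1
    have : (U - V).evalEval t0 y0 = 0 := by
      rw [hW, Polynomial.evalEval_mul, hr, zero_mul]
    rw [Polynomial.evalEval_sub] at this
    linarith
  have hCC : ∀ r : ℝ[X], (Polynomial.C r).evalEval t0 y0 = r.eval t0 := fun r => by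
    simp [Polynomial.evalEval]
  have hval : ∀ (a : A) (U : ℝ[X][X]), Polynomial.aeval y U = a →
      (Q a).evalEval t0 y0 / d.eval t0 = U.evalEval t0 y0 := by
    intro a U h
    rw [div_eq_iff hd]
    have := key (Q a) (Polynomial.C d * U) (by rw [hQ, map_mul, h, Polynomial.aeval_C])
    rw [this, Polynomial.evalEval_mul, hCC, mul_comm]
  let φ : A →ₐ[ℝ] ℝ :=
    { toFun := fun a => (Q a).evalEval t0 y0 / d.eval t0
      map_one' := by rw [hval 1 1 (by simp)]; simp
      map_zero' := by rw [hval 0 0 (by simp)]; simp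
      map_add' := fun a b => by
        have := key (Q (a + b)) (Q a + Q b) (by rw [map_add, hQ, hQ, hQ, mul_add])
        rw [this, Polynomial.evalEval_add, add_div]
      map_mul' := fun a b => by
        have := key (Polynomial.C d * Q (a * b)) (Q a * Q b)
          (by simp only [map_mul, hQ, Polynomial.aeval_C]; ring)
        rw [Polynomial.evalEval_mul, Polynomial.evalEval_mul, hCC] at this
        field_simp
        linarith
      commutes' := fun r => by
        rw [hval (algebraMap ℝ A r) (Polynomial.C (Polynomial.C r)) (by
          rw [Polynomial.aeval_C, IsScalarTower.algebraMap_apply ℝ ℝ[X] A]; rfl)]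
        rw [hCC]; simp }
  let x : S := ⟨_, D.lift φ⟩
  have hx : ∀ a, D.ev x a = φ a := by
    intro a
    obtain ⟨p, rfl⟩ := D.surj a
    rw [D.ev_π]
    have : (MvPolynomial.aeval (R := ℝ) x.1) = φ.comp D.π := by
      apply MvPolynomial.algHom_ext
      intro i
      simp [x]
    have h2 := DFunLike.congr_fun this p
    rw [MvPolynomial.aeval_eq_eval] at h2
    exact h2
  refine ⟨x, ?_, ?_⟩
  · rw [PD.τ, hx]
    change (Q _).evalEval t0 y0 / d.eval t0 = _
    rw [hval _ (Polynomial.C Polynomial.X) (by rw [Polynomial.aeval_C]), hCC, Polynomial.eval_X]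
  · rw [hx]
    change (Q _).evalEval t0 y0 / d.eval t0 = _
    rw [hval _ Polynomial.X (by rw [Polynomial.aeval_X]), Polynomial.evalEval_X]

lemma PD.local_open (D : PD S A) {y : A} {d : ℝ[X]}
    (hQ : ∀ a : A, ∃ Q : ℝ[X][X], Polynomial.aeval y Q = algebraMap ℝ[X] A d * a)
    {x : S} (hd : d.eval (D.τ x) ≠ 0)
    (h1 : D.ev x (Polynomial.aeval y (minpoly ℝ[X] y).derivative) ≠ 0)
    {V : Set S} (hV : IsOpen V) (hxV : x ∈ V) : D.τ '' V ∈ nhds (D.τ x) := by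
  set P := minpoly ℝ[X] y with hP
  have hroot : ∀ z : S, P.evalEval (D.τ z) (D.ev z y) = 0 := by
    intro z
    rw [← Polynomial.map_evalRingHom_eval, ← D.ev_aeval, hP, minpoly.aeval, map_zero]
  -- closeness
  have hclose : ∃ ε > 0, ∀ z : S, |D.τ z - D.τ x| < ε → |D.ev z y - D.ev x y| < ε → z ∈ V := by
    have hcomp : IsCompact ({z : S | |D.τ z| ≤ |D.τ x| + 1} ∩ Vᶜ) :=
      (D.compact _).inter_right hV.isClosed_compl
    have hcont : Continuous fun z : S => |D.τ z - D.τ x| + |D.ev z y - D.ev x y| :=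
      ((D.continuous_τ.sub continuous_const).abs).add
        (((D.continuous_ev y).sub continuous_const).abs)
    rcases Set.eq_empty_or_nonempty ({z : S | |D.τ z| ≤ |D.τ x| + 1} ∩ Vᶜ) with he | hne
    · refine ⟨1, one_pos, fun z hz _ => ?_⟩
      by_contra hzV
      have : z ∈ ({z : S | |D.τ z| ≤ |D.τ x| + 1} ∩ Vᶜ) := by
        refine ⟨?_, hzV⟩
        have := abs_sub_abs_le_abs_sub (D.τ z) (D.τ x)
        simp only [Set.mem_ofPred_eq]; linarith
      rw [he] at this
      exact this
    · obtain ⟨w, hw, hmin⟩ := hcomp.exists_isMinOn hne hcont.continuousOn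
      set c := |D.τ w - D.τ x| + |D.ev w y - D.ev x y| with hc
      have hcpos : 0 < c := by
        rcases (add_nonneg (abs_nonneg (D.τ w - D.τ x))
          (abs_nonneg (D.ev w y - D.ev x y))).lt_or_eq with h | h
        · exact h
        · exfalso
          have ha : |D.τ w - D.τ x| = 0 := by
            have := abs_nonneg (D.τ w - D.τ x)
            have := abs_nonneg (D.ev w y - D.ev x y)
            linarith
          have hb : |D.ev w y - D.ev x y| = 0 := by linarith
          rw [abs_eq_zero, sub_eq_zero] at ha hb
          have := D.inj_of_prim hQ hd ha.symm hb.symm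
          exact hw.2 (this ▸ hxV)
      refine ⟨min 1 (c / 2), by positivity, fun z hz1 hz2 => ?_⟩
      by_contra hzV
      have h1 := lt_min_iff.1 hz1
      have h2 := lt_min_iff.1 hz2
      have : z ∈ ({z : S | |D.τ z| ≤ |D.τ x| + 1} ∩ Vᶜ) := by
        refine ⟨?_, hzV⟩
        have := abs_sub_abs_le_abs_sub (D.τ z) (D.τ x)
        simp only [Set.mem_ofPred_eq]; linarith
      have h3 : c ≤ |D.τ z - D.τ x| + |D.ev z y - D.ev x y| := hmin this
      linarith
  obtain ⟨ε, hε, hclose⟩ := hclose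
  obtain ⟨y1, y2, hy1, hy1', hy2, hy2', hneg⟩ := sign_change
    (P.map (Polynomial.evalRingHom (D.τ x))) (D.ev x y)
    (by rw [Polynomial.map_evalRingHom_eval]; exact hroot x)
    (by rwa [Polynomial.derivative_map, ← D.ev_aeval]) ε hε
  rw [Polynomial.map_evalRingHom_eval, Polynomial.map_evalRingHom_eval] at hneg
  have hct : ∀ u, Continuous fun t => P.evalEval t u := fun u => by
    unfold Polynomial.evalEval; fun_prop
  have e1 : ∀ᶠ t in nhds (D.τ x), P.evalEval t y1 * P.evalEval t y2 < 0 :=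
    ((hct y1).mul (hct y2)).continuousAt.eventually (gt_mem_nhds hneg)
  have e2 : ∀ᶠ t in nhds (D.τ x), d.eval t ≠ 0 :=
    (d.continuous.continuousAt).eventually_ne hd
  have e3 : ∀ᶠ t in nhds (D.τ x), |t - D.τ x| < ε := by
    have := Metric.ball_mem_nhds (D.τ x) hε
    filter_upwards [this] with t ht
    rwa [Metric.mem_ball, Real.dist_eq] at ht
  filter_upwards [e1, e2, e3] with t h1 h2 h3
  have hcy : Continuous fun u => P.evalEval t u := by
    have : (fun u => P.evalEval t u) = fun u => (P.map (Polynomial.evalRingHom t)).eval u := by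
      ext u; rw [Polynomial.map_evalRingHom_eval]
    rw [this]; fun_prop
  have hivt : ∃ u ∈ Set.Icc y1 y2, P.evalEval t u = 0 := by
    rcases mul_neg_iff.1 h1 with ⟨ha, hb⟩ | ⟨ha, hb⟩
    · exact intermediate_value_Icc' (by linarith) hcy.continuousOn ⟨hb.le, ha.le⟩
    · exact intermediate_value_Icc (by linarith) hcy.continuousOn ⟨ha.le, hb.le⟩
  obtain ⟨u, hu, hu0⟩ := hivt
  obtain ⟨z, hz1, hz2⟩ := D.lift_of_prim hQ h2 hu0
  refine ⟨z, hclose z (by rwa [hz1]) ?_, hz1⟩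
  rw [hz2, abs_lt]
  constructor <;> linarith [hu.1, hu.2]

lemma PD.transport (D : PD S A) {y : A} {d : ℝ[X]}
    (hQ : ∀ a : A, ∃ Q : ℝ[X][X], Polynomial.aeval y Q = algebraMap ℝ[X] A d * a)
    {J : Set ℝ} (hJ : IsPreconnected J) (hd : ∀ t ∈ J, d.eval t ≠ 0)
    (h1 : ∀ z : S, D.τ z ∈ J → D.ev z (Polynomial.aeval y (minpoly ℝ[X] y).derivative) ≠ 0)
    {U K : Set S} (hU : IsOpen U) (hK : IsClosed K) (hUK : U ⊆ K)
    (hKU : ∀ z ∈ K, D.τ z ∈ J → z ∈ U) {x : S} (hx : x ∈ U) (hxJ : D.τ x ∈ J) :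
    ∀ t ∈ J, ∃ z ∈ U, D.τ z = t := by
  have hnh : ∀ z ∈ U, D.τ z ∈ J → D.τ z ∈ interior (D.τ '' U) := fun z hz hzJ =>
    mem_interior_iff_mem_nhds.2 (D.local_open hQ (hd _ hzJ) (h1 z hzJ) hU hz)
  have := hJ.subset_of_closure_inter_subset (u := interior (D.τ '' U)) isOpen_interior
    ⟨_, hxJ, hnh x hx hxJ⟩ (by
      rintro t ⟨ht, htJ⟩
      have : t ∈ D.τ '' K := by
        refine closure_minimal ?_ (D.isClosed_image hK) ht
        exact interior_subset.trans (Set.image_mono hUK)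
      obtain ⟨z, hz, rfl⟩ := this
      exact hnh z (hKU z hz htJ) htJ)
  intro t ht
  obtain ⟨z, hz, h⟩ := interior_subset (this ht)
  exact ⟨z, hz, h⟩

lemma PD.sign_transfer (D : PD S A) {y : A} {d : ℝ[X]}
    (hQ : ∀ a : A, ∃ Q : ℝ[X][X], Polynomial.aeval y Q = algebraMap ℝ[X] A d * a)
    (f : S → ℝ) (hf : Continuous f) (x x' : S)
    (hd : ∀ t ∈ Set.uIcc (D.τ x) (D.τ x'), d.eval t ≠ 0)
    (hfz : ∀ z : S, D.τ z ∈ Set.uIcc (D.τ x) (D.τ x') → f z ≠ 0)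
    (hg : ∀ z : S, D.τ z ∈ Set.uIcc (D.τ x) (D.τ x') → ∀ j, 1 ≤ j →
      j ≤ (minpoly ℝ[X] y).natDegree →
      D.ev z (Polynomial.aeval y (Polynomial.derivative^[j] (minpoly ℝ[X] y))) ≠ 0)
    (hs : ∀ j, 1 ≤ j → j ≤ (minpoly ℝ[X] y).natDegree →
      0 < D.ev x (Polynomial.aeval y (Polynomial.derivative^[j] (minpoly ℝ[X] y))) *
        D.ev x' (Polynomial.aeval y (Polynomial.derivative^[j] (minpoly ℝ[X] y))))
    (hpos : 0 < f x) : 0 < f x' := by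
  have hint : IsIntegral ℝ[X] y := Algebra.IsIntegral.isIntegral y
  have hmon := minpoly.monic hint
  have hdeg := minpoly.natDegree_pos hint
  set P := minpoly ℝ[X] y with hP
  let g : ℕ → A := fun j => Polynomial.aeval y (Polynomial.derivative^[j] P)
  let U : Set S := {z | 0 < f z} ∩ ⋂ j ∈ Set.Icc 1 P.natDegree, {z | 0 < D.ev x (g j) * D.ev z (g j)}
  let K : Set S := {z | 0 ≤ f z} ∩ ⋂ j ∈ Set.Icc 1 P.natDegree, {z | 0 ≤ D.ev x (g j) * D.ev z (g j)}
  have hU : IsOpen U := (isOpen_lt continuous_const hf).inter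
    ((Set.finite_Icc _ _).isOpen_biInter fun j _ =>
      isOpen_lt continuous_const (continuous_const.mul (D.continuous_ev _)))
  have hK : IsClosed K := (isClosed_le continuous_const hf).inter
    (isClosed_biInter fun j _ =>
      isClosed_le continuous_const (continuous_const.mul (D.continuous_ev _)))
  have hUK : U ⊆ K := by
    rintro z ⟨hz1, hz2⟩
    refine ⟨(show (0 : ℝ) ≤ f z from le_of_lt hz1), ?_⟩
    simp only [Set.mem_iInter] at hz2 ⊢
    exact fun j hj => (show (0 : ℝ) ≤ D.ev x (g j) * D.ev z (g j) from le_of_lt (hz2 j hj))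
  have hxJ : D.τ x ∈ Set.uIcc (D.τ x) (D.τ x') := Set.left_mem_uIcc
  have hxJ' : D.τ x' ∈ Set.uIcc (D.τ x) (D.τ x') := Set.right_mem_uIcc
  have hKU : ∀ z ∈ K, D.τ z ∈ Set.uIcc (D.τ x) (D.τ x') → z ∈ U := by
    rintro z ⟨hz1, hz2⟩ hzJ
    refine ⟨(show (0 : ℝ) < f z from lt_of_le_of_ne hz1 (hfz z hzJ).symm), ?_⟩
    simp only [Set.mem_iInter] at hz2 ⊢
    exact fun j hj => show (0 : ℝ) < D.ev x (g j) * D.ev z (g j) from lt_of_le_of_ne (hz2 j hj)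
      (mul_ne_zero (hg x hxJ j hj.1 hj.2) (hg z hzJ j hj.1 hj.2)).symm
  have hxU : x ∈ U := by
    refine ⟨hpos, ?_⟩
    simp only [Set.mem_iInter]
    intro j hj
    have := hg x hxJ j hj.1 hj.2
    exact mul_self_pos.2 this
  obtain ⟨z, hz, hzt⟩ := D.transport hQ isPreconnected_uIcc hd
    (fun z hz => by simpa using hg z hz 1 le_rfl hdeg) hU hK hUK hKU hxU hxJ _ hxJ'
  have hzy : D.ev z y = D.ev x' y := by
    apply thom (P.map (Polynomial.evalRingHom (D.τ x')))
    · rw [← hzt, ← D.ev_aeval, hP, minpoly.aeval, map_zero]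
    · rw [← D.ev_aeval, hP, minpoly.aeval, map_zero]
    · intro j hj1 hj2
      rw [hmon.natDegree_map] at hj2
      have h1 := hs j hj1 hj2
      have h2 : 0 < D.ev x (g j) * D.ev z (g j) := by
        have := hz.2
        simp only [Set.mem_iInter] at this
        exact this j ⟨hj1, hj2⟩
      rw [Polynomial.iterate_derivative_map]
      have h3 := D.ev_aeval z y (Polynomial.derivative^[j] P)
      have h4 := D.ev_aeval x' y (Polynomial.derivative^[j] P)
      rw [hzt] at h3
      rw [← h3, ← h4]
      have h5 := mul_pos h1 h2
      have h6 : 0 < D.ev x (g j) ^ 2 := by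
        have := hg x hxJ j hj1 hj2
        positivity
      change 0 < D.ev z (g j) * D.ev x' (g j)
      change 0 < D.ev x (g j) * D.ev x' (g j) * (D.ev x (g j) * D.ev z (g j)) at h5
      by_contra hcon
      push Not at hcon
      nlinarith
    · rwa [hmon.natDegree_map]
  have : z = x' := D.inj_of_prim hQ (by rw [hzt]; exact hd _ hxJ') hzt hzy
  rw [← this]
  exact hz.1
end curve2


section curve3
set_option linter.unusedSectionVars false
variable {n : ℕ} {S : Set (Fin n → ℝ)} {A : Type*} [CommRing A] [Algebra ℝ A]
  [Algebra ℝ[X] A] [IsScalarTower ℝ ℝ[X] A] [Module.Finite ℝ[X] A] [IsDomain A]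
  [Module.IsTorsionFree ℝ[X] A]

/-- subsets which are, up to finitely many points, given by one strict inequality -/
def PD.Good (D : PD S A) (T : Set S) : Prop :=
  ∃ c : A, c ≠ 0 ∧ ∃ E : Set S, E.Finite ∧ ∀ x ∉ E, (x ∈ T ↔ 0 < D.ev x c)

lemma PD.Good.congr {D : PD S A} {T T' : Set S} (h : D.Good T) {E : Set S} (hE : E.Finite)
    (hT : ∀ x ∉ E, (x ∈ T' ↔ x ∈ T)) : D.Good T' := by
  obtain ⟨c, hc, F, hF, h⟩ := h
  refine ⟨c, hc, E ∪ F, hE.union hF, fun x hx => ?_⟩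
  rw [Set.mem_union, not_or] at hx
  rw [hT x hx.1, h x hx.2]

lemma PD.good_univ (D : PD S A) : D.Good Set.univ :=
  ⟨1, one_ne_zero, ∅, Set.finite_empty, fun x _ => by simp⟩

lemma PD.good_pos (D : PD S A) {c : A} (hc : c ≠ 0) : D.Good {x | 0 < D.ev x c} :=
  ⟨c, hc, ∅, Set.finite_empty, fun x _ => Iff.rfl⟩

lemma PD.Good.compl {D : PD S A} {T : Set S} (h : D.Good T) : D.Good Tᶜ := by
  obtain ⟨c, hc, F, hF, h⟩ := h
  refine ⟨-c, neg_ne_zero.2 hc, F ∪ {x | D.ev x c = 0}, hF.union (D.zeros_finite hc),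
    fun x hx => ?_⟩
  rw [Set.mem_union, not_or] at hx
  have h2 : D.ev x c ≠ 0 := hx.2
  rw [Set.mem_compl_iff, h x hx.1, map_neg, Left.neg_pos_iff, not_lt]
  exact ⟨fun h => lt_of_le_of_ne h h2, le_of_lt⟩

lemma PD.good_neg_pos (D : PD S A) {a b : A} (ha : a ≠ 0) (hb : b ≠ 0) :
    D.Good {x | D.ev x a < 0 ∧ 0 < D.ev x b} := by
  obtain ⟨x, y, z, w, hne, h⟩ := isotropic a b
  have hz := D.zeros_finite ha
  by_cases hc : x ^ 2 + a * y ^ 2 = 0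
  · by_cases hy : y = 0
    · have hx : x = 0 := by simpa [hy] using hc
      -- a w^2 = z^2
      have hw2 : b * (a * w ^ 2 - z ^ 2) = 0 := by
        rw [hy, hx] at h
        linear_combination -h
      have hw3 : a * w ^ 2 - z ^ 2 = 0 := (mul_eq_zero.1 hw2).resolve_left hb
      have hw : w ≠ 0 := by
        intro hw
        have hz0 : z = 0 := by simpa [hw] using hw3
        exact hne ⟨hx, hy, hz0, hw⟩
      refine ⟨-1, by simp, {p | D.ev p w = 0}, D.zeros_finite hw, fun p hp => ?_⟩
      have hp : D.ev p w ≠ 0 := hp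
      have := congrArg (D.ev p) hw3
      simp only [map_sub, map_mul, map_pow, map_zero] at this
      have hpos : 0 < D.ev p w ^ 2 := by positivity
      have h2 : 0 ≤ D.ev p a := by
        by_contra hcon
        push Not at hcon
        nlinarith [sq_nonneg (D.ev p z)]
      simp only [Set.mem_ofPred_eq, map_neg, map_one]
      constructor
      · intro h3; linarith [h3.1]
      · intro h3; linarith
    · refine ⟨b, hb, {p | D.ev p y = 0} ∪ {p | D.ev p a = 0}, (D.zeros_finite hy).union hz,
        fun p hp => ?_⟩
      rw [Set.mem_union, not_or] at hp
      have hp1 : D.ev p y ≠ 0 := hp.1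
      have hp2 : D.ev p a ≠ 0 := hp.2
      have := congrArg (D.ev p) hc
      simp only [map_add, map_mul, map_pow, map_zero] at this
      have hpos : 0 < D.ev p y ^ 2 := by positivity
      have h2 : D.ev p a ≤ 0 := by
        by_contra hcon
        push Not at hcon
        nlinarith [sq_nonneg (D.ev p x), mul_pos hcon hpos]
      simp only [Set.mem_ofPred_eq]
      exact ⟨fun h => h.2, fun h => ⟨lt_of_le_of_ne h2 hp2, h⟩⟩
  · have hc2 : x ^ 2 + a * y ^ 2 = b * (a * w ^ 2 - z ^ 2) := by linear_combination h
    refine ⟨-(x ^ 2 + a * y ^ 2), neg_ne_zero.2 hc,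
      {p | D.ev p (x ^ 2 + a * y ^ 2) = 0} ∪ ({p | D.ev p a = 0} ∪ {p | D.ev p b = 0}),
      (D.zeros_finite hc).union (hz.union (D.zeros_finite hb)), fun p hp => ?_⟩
    rw [Set.mem_union, Set.mem_union, not_or, not_or] at hp
    obtain ⟨hp0, hp1, hp2⟩ := hp
    have hp0 : D.ev p (x ^ 2 + a * y ^ 2) ≠ 0 := hp0
    have hp1 : D.ev p a ≠ 0 := hp1
    have hp2 : D.ev p b ≠ 0 := hp2
    have h3 := congrArg (D.ev p) hc2
    simp only [Set.mem_ofPred_eq, map_neg]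
    have h4 : D.ev p (x ^ 2 + a * y ^ 2) = D.ev p x ^ 2 + D.ev p a * D.ev p y ^ 2 := by simp
    have h5 : D.ev p (b * (a * w ^ 2 - z ^ 2)) =
      D.ev p b * (D.ev p a * D.ev p w ^ 2 - D.ev p z ^ 2) := by simp
    rw [h5] at h3
    rw [Left.neg_pos_iff]
    constructor
    · rintro ⟨h6, h7⟩
      refine lt_of_le_of_ne ?_ hp0
      rw [h3]
      have : D.ev p a * D.ev p w ^ 2 ≤ 0 := mul_nonpos_of_nonpos_of_nonneg h6.le (sq_nonneg _)
      exact mul_nonpos_of_nonneg_of_nonpos h7.le (by nlinarith [sq_nonneg (D.ev p z)])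
    · intro h6
      have h7 : D.ev p a < 0 := by
        by_contra hcon
        push Not at hcon
        have := mul_nonneg hcon (sq_nonneg (D.ev p y))
        nlinarith [sq_nonneg (D.ev p x)]
      refine ⟨h7, ?_⟩
      have h8 : D.ev p a * D.ev p w ^ 2 ≤ 0 := mul_nonpos_of_nonpos_of_nonneg h7.le (sq_nonneg _)
      by_contra hcon
      push Not at hcon
      have : D.ev p a * D.ev p w ^ 2 - D.ev p z ^ 2 ≤ 0 := by nlinarith [sq_nonneg (D.ev p z)]
      have := mul_nonneg_of_nonpos_of_nonpos hcon this
      linarith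

lemma PD.Good.inter {D : PD S A} {T T' : Set S} (h : D.Good T) (h' : D.Good T') :
    D.Good (T ∩ T') := by
  obtain ⟨c, hc, F, hF, h⟩ := h
  obtain ⟨c', hc', F', hF', h'⟩ := h'
  refine (D.good_neg_pos (neg_ne_zero.2 hc) hc').congr (hF.union hF') fun x hx => ?_
  rw [Set.mem_union, not_or] at hx
  rw [Set.mem_inter_iff, h x hx.1, h' x hx.2]
  simp

lemma PD.good_biInter {D : PD S A} {ι : Type*} (s : Finset ι) (T : ι → Set S)
    (h : ∀ i ∈ s, D.Good (T i)) : D.Good (⋂ i ∈ s, T i) := by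
  classical
  induction s using Finset.induction_on with
  | empty => simpa using D.good_univ
  | insert i s hi ih =>
    rw [Finset.set_biInter_insert]
    exact (h i (by simp)).inter (ih fun j hj => h j (by simp [hj]))

lemma PD.good_biUnion {D : PD S A} {ι : Type*} (s : Finset ι) (T : ι → Set S)
    (h : ∀ i ∈ s, D.Good (T i)) : D.Good (⋃ i ∈ s, T i) := by
  have := (PD.good_biInter s (fun i => (T i)ᶜ) fun i hi => (h i hi).compl).compl
  simpa [Set.compl_iInter] using this

lemma PD.good_of_signs (D : PD S A) (G : Finset A) (hG : ∀ g ∈ G, g ≠ 0) {E : Set S}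
    (hE : E.Finite) (T : Set S)
    (h : ∀ x ∉ E, ∀ x' ∉ E, (∀ g ∈ G, 0 < D.ev x g ↔ 0 < D.ev x' g) → x ∈ T → x' ∈ T) :
    D.Good T := by
  classical
  let C : Finset A → Set S := fun H => ⋂ g ∈ G, {x | 0 < D.ev x g ↔ g ∈ H}
  have hC : ∀ H, D.Good (C H) := by
    intro H
    refine PD.good_biInter _ _ fun g hg => ?_
    by_cases hgH : g ∈ H
    · simpa [hgH] using D.good_pos (hG g hg)
    · have := (D.good_pos (hG g hg)).compl
      refine this.congr Set.finite_empty fun x _ => ?_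
      simp [hgH]
  have hU := PD.good_biUnion (G.powerset.filter fun H => ∃ x ∉ E, x ∈ T ∧ x ∈ C H) C
    (fun H _ => hC H)
  refine hU.congr hE fun x hx => ?_
  have hmem : ∀ (z : S) (H : Finset A), z ∈ C H ↔ ∀ g ∈ G, (0 < D.ev z g ↔ g ∈ H) := by
    intro z H; simp [C]
  simp only [Set.mem_iUnion, Finset.mem_filter, Finset.mem_powerset]
  constructor
  · intro hxT
    have hxC : x ∈ C (G.filter fun g => 0 < D.ev x g) := by
      rw [hmem]; intro g hg; simp [hg]
    exact ⟨_, ⟨Finset.filter_subset _ _, x, hx, hxT, hxC⟩, hxC⟩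
  · rintro ⟨H, ⟨_, z, hz, hzT, hzC⟩, hxC⟩
    rw [hmem] at hzC hxC
    exact h z hz x hx (fun g hg => (hzC g hg).trans (hxC g hg).symm) hzT

lemma deriv_minpoly_ne (y : A) (j : ℕ) (hj1 : 1 ≤ j) (hj : j ≤ (minpoly ℝ[X] y).natDegree) :
    Polynomial.aeval y (Polynomial.derivative^[j] (minpoly ℝ[X] y)) ≠ 0 := by
  intro h
  have hint : IsIntegral ℝ[X] y := Algebra.IsIntegral.isIntegral y
  have hdvd := minpoly.isIntegrallyClosed_dvd hint h
  have hlt : (Polynomial.derivative^[j] (minpoly ℝ[X] y)).natDegree <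
      (minpoly ℝ[X] y).natDegree :=
    lt_of_le_of_lt (Polynomial.natDegree_iterate_derivative _ _) (by omega)
  have h0 := Polynomial.eq_zero_of_dvd_of_natDegree_lt hdvd hlt
  have := congrArg (fun p => Polynomial.coeff p ((minpoly ℝ[X] y).natDegree - j)) h0
  simp only [Polynomial.coeff_iterate_derivative, Polynomial.coeff_zero] at this
  rw [Nat.sub_add_cancel hj, Polynomial.coeff_natDegree, (minpoly.monic hint).leadingCoeff,
    nsmul_eq_mul, mul_one, Nat.cast_eq_zero, Nat.descFactorial_eq_zero_iff_lt] at this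
  omega

lemma PD.good_cont (D : PD S A) (f : S → ℝ) (hf : Continuous f)
    (hz : {x | f x = 0}.Finite) : D.Good {x | 0 < f x} := by
  classical
  obtain ⟨y, d, hd, hQ⟩ := prim_elt (A := A)
  set P := minpoly ℝ[X] y with hP
  let g : ℕ → A := fun j => Polynomial.aeval y (Polynomial.derivative^[j] P)
  have hg0 : ∀ j ∈ Finset.Icc 1 P.natDegree, g j ≠ 0 := fun j hj =>
    deriv_minpoly_ne y j (Finset.mem_Icc.1 hj).1 (Finset.mem_Icc.1 hj).2
  have hBfin : ({t | d.IsRoot t} ∪ D.τ '' {x | f x = 0} ∪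
      ⋃ j ∈ Finset.Icc 1 P.natDegree, D.τ '' {x | D.ev x (g j) = 0}).Finite := by
    refine ((Polynomial.finite_setOfPred_isRoot hd).union (hz.image _)).union ?_
    exact Set.Finite.biUnion (Finset.finite_toSet _) fun j hj =>
      (D.zeros_finite (hg0 j hj)).image _
  set B := hBfin.toFinset with hB
  have hB1 : ∀ t, t ∉ B → d.eval t ≠ 0 := by
    intro t ht h
    apply ht
    rw [hB, Set.Finite.mem_toFinset]
    exact Or.inl (Or.inl h)
  have hB2 : ∀ x : S, D.τ x ∉ B → f x ≠ 0 := by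
    intro x ht h
    apply ht
    rw [hB, Set.Finite.mem_toFinset]
    exact Or.inl (Or.inr ⟨x, h, rfl⟩)
  have hB3 : ∀ x : S, D.τ x ∉ B → ∀ j, 1 ≤ j → j ≤ P.natDegree → D.ev x (g j) ≠ 0 := by
    intro x ht j h1 h2 h
    apply ht
    rw [hB, Set.Finite.mem_toFinset]
    refine Or.inr ?_
    simp only [Set.mem_iUnion]
    exact ⟨j, Finset.mem_Icc.2 ⟨h1, h2⟩, x, h, rfl⟩
  have hinj : Function.Injective (algebraMap ℝ[X] A) := FaithfulSMul.algebraMap_injective _ _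
  let l : ℝ → A := fun b => algebraMap ℝ[X] A (Polynomial.X - Polynomial.C b)
  have hl : ∀ x b, D.ev x (l b) = D.τ x - b := fun x b => by
    simp only [l]; rw [D.ev_algebraMap]; simp
  have hEfin : {x : S | D.τ x ∈ B}.Finite := by
    have : {x : S | D.τ x ∈ B} = ⋃ b ∈ B, {x | D.τ x = b} := by ext x; simp
    rw [this]
    exact Set.Finite.biUnion (Finset.finite_toSet _) fun b _ => D.fiber_finite b
  refine D.good_of_signs ((Finset.Icc 1 P.natDegree).image g ∪ B.image l) ?_ hEfin _ ?_
  · intro a ha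
    rw [Finset.mem_union, Finset.mem_image, Finset.mem_image] at ha
    rcases ha with ⟨j, hj, rfl⟩ | ⟨b, _, rfl⟩
    · exact hg0 j hj
    · simp only [l]
      rw [Ne, map_eq_zero_iff _ hinj]
      exact Polynomial.X_sub_C_ne_zero b
  · intro x hx x' hx' hs hpos
    have hx : D.τ x ∉ B := hx
    have hx' : D.τ x' ∉ B := hx'
    have hJ : ∀ t ∈ Set.uIcc (D.τ x) (D.τ x'), t ∉ B := by
      intro t ht htB
      have h1 := hs (l t) (Finset.mem_union_right _ (Finset.mem_image_of_mem _ htB))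
      rw [hl, hl] at h1
      have h2 : D.τ x ≠ t := fun h => hx (h ▸ htB)
      have h3 : D.τ x' ≠ t := fun h => hx' (h ▸ htB)
      rcases Set.mem_uIcc.1 ht with ⟨h4, h5⟩ | ⟨h4, h5⟩
      · have h6 := lt_of_le_of_ne h5 h3.symm
        have := h1.2 (by linarith)
        linarith
      · have h6 := lt_of_le_of_ne h5 h2.symm
        have := h1.1 (by linarith)
        linarith
    refine D.sign_transfer hQ f hf x x' (fun t ht => hB1 t (hJ t ht)) (fun z hz => hB2 z (hJ _ hz))
      (fun z hz j h1 h2 => hB3 z (hJ _ hz) j h1 h2) (fun j h1 h2 => ?_) hpos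
    have h3 := hs (g j) (Finset.mem_union_left _
      (Finset.mem_image_of_mem _ (Finset.mem_Icc.2 ⟨h1, h2⟩)))
    have h4 := hB3 x hx j h1 h2
    have h5 := hB3 x' hx' j h1 h2
    change 0 < D.ev x (g j) * D.ev x' (g j)
    rcases lt_or_gt_of_ne h4 with h6 | h6
    · refine mul_pos_of_neg_of_neg h6 (lt_of_le_of_ne ?_ h5)
      by_contra hcon
      push Not at hcon
      linarith [h3.2 hcon]
    · exact mul_pos h6 (h3.1 h6)

end curve3


lemma poly_lower (N : ℝ[X]) (hN : N ≠ 0) : ∃ T c : ℝ, 0 < c ∧ ∀ t, T ≤ |t| → c ≤ |N.eval t| := by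
  rcases le_or_gt N.degree 0 with h | h
  · obtain ⟨c, rfl⟩ : ∃ c, N = Polynomial.C c := ⟨_, Polynomial.eq_C_of_degree_le_zero h⟩
    refine ⟨0, |c|, ?_, fun t _ => by simp⟩
    simpa using hN
  · have := Polynomial.tendsto_norm_atTop N h
      (Filter.tendsto_comap (f := fun t : ℝ => ‖t‖) (x := Filter.atTop))
    have h1 := this.eventually_ge_atTop 1
    rw [Filter.eventually_comap] at h1
    obtain ⟨T, hT⟩ := Filter.eventually_atTop.1 h1
    exact ⟨T, 1, one_pos, fun t ht => hT |t| ht t rfl⟩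

section curve4
set_option linter.unusedSectionVars false
variable {n : ℕ} {S : Set (Fin n → ℝ)} {A : Type*} [CommRing A] [Algebra ℝ A]
  [Algebra ℝ[X] A] [IsScalarTower ℝ ℝ[X] A] [Module.Finite ℝ[X] A] [IsDomain A]
  [Module.IsTorsionFree ℝ[X] A]

lemma artinian_quot (a : A) {N : ℝ[X]} (hN : N ≠ 0) {a' : A}
    (h : a * a' = algebraMap ℝ[X] A N) : IsArtinianRing (A ⧸ Ideal.span {a}) := by
  let B := A ⧸ Ideal.span {a}
  have hfin : Module.Finite ℝ (AdjoinRoot N) := (AdjoinRoot.powerBasis hN).finite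
  have hart : IsArtinianRing (AdjoinRoot N) := IsArtinianRing.of_finite ℝ _
  let f : AdjoinRoot N →+* B := Ideal.Quotient.lift (Ideal.span {N})
    ((Ideal.Quotient.mk (Ideal.span {a})).comp (algebraMap ℝ[X] A)) (by
      intro p hp
      obtain ⟨r, rfl⟩ := Ideal.mem_span_singleton.1 hp
      rw [RingHom.comp_apply, map_mul, ← h, Ideal.Quotient.eq_zero_iff_mem, mul_assoc, ]
      exact Ideal.mul_mem_right _ _ (Ideal.mem_span_singleton_self a))
  have hf : f.Finite := by
    apply RingHom.Finite.of_comp_finite (f := AdjoinRoot.mk N)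
    have : f.comp (AdjoinRoot.mk N) =
      (Ideal.Quotient.mk (Ideal.span {a})).comp (algebraMap ℝ[X] A) := rfl
    rw [this]
    refine RingHom.Finite.comp (RingHom.Finite.of_surjective _ Ideal.Quotient.mk_surjective) ?_
    exact RingHom.finite_algebraMap.2 inferInstance
  let : Algebra (AdjoinRoot N) B := f.toAlgebra
  have : Module.Finite (AdjoinRoot N) B := hf
  exact IsArtinianRing.of_finite (AdjoinRoot N) B

lemma PD.loj (D : PD S A) {a h : A} (ha : a ≠ 0) {R : Set S} (hRc : IsClosed R)
    (hR : ∀ x ∈ R, D.ev x a = 0 → D.ev x h = 0) :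
    ∃ (N : ℕ) (w : A), ∀ x ∈ R, |D.ev x h| ^ N ≤ D.ev x w * |D.ev x a| := by
  obtain ⟨N, a', hN, haa'⟩ := D.exists_norm ha
  have := artinian_quot a hN haa'
  obtain ⟨k, y, hy⟩ := IsArtinian.exists_pow_succ_smul_dvd
    (Ideal.Quotient.mk (Ideal.span {a}) h) (1 : A ⧸ Ideal.span {a})
  obtain ⟨u, rfl⟩ := Ideal.Quotient.mk_surjective y
  have hq : h ^ k * (1 - h * u) ∈ Ideal.span {a} := by
    rw [← Ideal.Quotient.eq_zero_iff_mem]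
    simp only [smul_eq_mul, Nat.succ_eq_add_one] at hy
    simp only [map_mul, map_sub, map_pow, map_one]
    linear_combination -hy
  obtain ⟨q, hq⟩ := Ideal.mem_span_singleton.1 hq
  set v := 1 - h * u with hv
  let R' : Set S := R ∩ {x | |D.ev x v| ≤ 1 / 2}
  have hR'c : IsClosed R' := hRc.inter (isClosed_le (D.continuous_ev v).abs continuous_const)
  have hR'0 : ∀ x ∈ R', D.ev x a ≠ 0 := by
    rintro x ⟨hx1, hx2⟩ hx0
    have h1 := hR x hx1 hx0
    have h2 : |D.ev x v| ≤ 1 / 2 := hx2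
    rw [hv, map_sub, map_mul, h1] at h2
    norm_num at h2
  have hc : ∃ c > 0, ∀ x ∈ R', c ≤ |D.ev x a| * (1 + D.ev x a' ^ 2) := by
    obtain ⟨T, c0, hc0, hT⟩ := poly_lower N hN
    have hbig : ∀ x, T ≤ |D.τ x| → c0 ≤ |D.ev x a| * (1 + D.ev x a' ^ 2) := by
      intro x hx
      have h1 := hT _ hx
      rw [← D.ev_algebraMap, ← haa', map_mul, abs_mul] at h1
      refine h1.trans (mul_le_mul_of_nonneg_left ?_ (abs_nonneg _))
      rw [← sq_abs]
      nlinarith [sq_nonneg (|D.ev x a'| - 1), abs_nonneg (D.ev x a')]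
    have hcomp : IsCompact (R' ∩ {x : S | |D.τ x| ≤ T}) := (D.compact T).inter_left hR'c
    have hcont : Continuous fun x : S => |D.ev x a| * (1 + D.ev x a' ^ 2) :=
      (D.continuous_ev a).abs.mul (continuous_const.add ((D.continuous_ev a').pow 2))
    rcases Set.eq_empty_or_nonempty (R' ∩ {x : S | |D.τ x| ≤ T}) with he | hne
    · refine ⟨c0, hc0, fun x hx => hbig x ?_⟩
      by_contra hcon
      push Not at hcon
      have : x ∈ R' ∩ {x : S | |D.τ x| ≤ T} := ⟨hx, hcon.le⟩
      rw [he] at this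
      exact this
    · obtain ⟨w, hw, hmin⟩ := hcomp.exists_isMinOn hne hcont.continuousOn
      have hw0 := hR'0 w hw.1
      refine ⟨min c0 (|D.ev w a| * (1 + D.ev w a' ^ 2)), lt_min hc0 (by positivity), ?_⟩
      intro x hx
      rcases le_total T |D.τ x| with h | h
      · exact (min_le_left _ _).trans (hbig x h)
      · exact (min_le_right _ _).trans (hmin (a := x) ⟨hx, h⟩)
  obtain ⟨c, hc0, hc⟩ := hc
  refine ⟨k, 2 * (1 + q ^ 2) + algebraMap ℝ A c⁻¹ * ((1 + (h ^ k) ^ 2) * (1 + a' ^ 2)), ?_⟩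
  intro x hx
  simp only [map_add, map_mul, map_pow, map_one, map_ofNat, AlgHom.commutes]
  simp only [Algebra.algebraMap_self, RingHom.id_apply]
  have hq' := congrArg (fun z => |D.ev x z|) hq
  simp only [map_mul, abs_mul, map_pow, abs_pow] at hq'
  have p1 : 0 ≤ |D.ev x a| := abs_nonneg _
  by_cases hxv : |D.ev x v| ≤ 1 / 2
  · have h1 := hc x ⟨hx, hxv⟩
    have h2 : |D.ev x h| ^ k ≤ 1 + (D.ev x h ^ k) ^ 2 := by
      rw [← sq_abs (D.ev x h ^ k), abs_pow]
      nlinarith [sq_nonneg (|D.ev x h| ^ k - 1), pow_nonneg (abs_nonneg (D.ev x h)) k]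
    have h3 : 1 ≤ c⁻¹ * (|D.ev x a| * (1 + D.ev x a' ^ 2)) := by
      rw [inv_mul_eq_div, le_div_iff₀ hc0, one_mul]; exact h1
    have h4 : (1 + (D.ev x h ^ k) ^ 2) * 1 ≤
      (1 + (D.ev x h ^ k) ^ 2) * (c⁻¹ * (|D.ev x a| * (1 + D.ev x a' ^ 2))) :=
      mul_le_mul_of_nonneg_left h3 (by positivity)
    have h5 : 0 ≤ 2 * (1 + D.ev x q ^ 2) * |D.ev x a| := by positivity
    nlinarith
  · push Not at hxv
    have h1 : |D.ev x h| ^ k ≤ 2 * (|D.ev x h| ^ k * |D.ev x v|) := by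
      nlinarith [pow_nonneg (abs_nonneg (D.ev x h)) k]
    rw [hq'] at h1
    have h2 : |D.ev x q| ≤ 1 + D.ev x q ^ 2 := by
      rw [← sq_abs]
      nlinarith [sq_nonneg (|D.ev x q| - 1), abs_nonneg (D.ev x q)]
    have h3 := mul_le_mul_of_nonneg_left h2 p1
    have h4 : 0 ≤ c⁻¹ * ((1 + (D.ev x h ^ k) ^ 2) * (1 + D.ev x a' ^ 2)) * |D.ev x a| := by
      positivity
    nlinarith
end curve4


lemma noether_curve (A : Type*) [CommRing A] [IsDomain A] [Algebra ℝ A] [Algebra.FiniteType ℝ A]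
    [Ring.KrullDimLE 1 A] :
    Module.Finite ℝ A ∨ ∃ g : ℝ[X] →ₐ[ℝ] A, Function.Injective g ∧ g.Finite := by
  obtain ⟨s, g, hinj, hfin⟩ := exists_finite_inj_algHom_of_fg ℝ A
  rcases s with _ | _ | s
  · left
    have h1 : (algebraMap ℝ (MvPolynomial (Fin 0) ℝ)).Finite :=
      RingHom.Finite.of_surjective _ (MvPolynomial.C_surjective (Fin 0))
    have h2 : (g.toRingHom.comp (algebraMap ℝ (MvPolynomial (Fin 0) ℝ))).Finite :=
      RingHom.Finite.comp hfin h1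
    have h3 : g.toRingHom.comp (algebraMap ℝ (MvPolynomial (Fin 0) ℝ)) = algebraMap ℝ A := by
      ext r; simp
    rw [h3] at h2
    exact RingHom.finite_algebraMap.1 h2
  · right
    let e := MvPolynomial.uniqueAlgEquiv ℝ (Fin 1)
    refine ⟨g.comp e.symm.toAlgHom, hinj.comp e.symm.injective, ?_⟩
    exact AlgHom.Finite.comp hfin (AlgHom.Finite.of_surjective _ e.symm.surjective)
  · exfalso
    let : Algebra (MvPolynomial (Fin (s + 2)) ℝ) A := g.toRingHom.toAlgebra
    have : Module.Finite (MvPolynomial (Fin (s + 2)) ℝ) A := hfin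
    have hint : Algebra.IsIntegral (MvPolynomial (Fin (s + 2)) ℝ) A := inferInstance
    let φ : MvPolynomial (Fin (s + 2)) ℝ →ₐ[ℝ] MvPolynomial (Fin (s + 2)) ℝ :=
      MvPolynomial.aeval fun i => if i = 0 then 0 else MvPolynomial.X i
    let P := RingHom.ker φ.toRingHom
    have hP : P.IsPrime := RingHom.ker_isPrime _
    obtain ⟨Q, hQ, hQP⟩ := Ideal.exists_ideal_over_prime_of_isIntegral_of_isDomain
      (S := A) P (by
        intro x hx
        have : g x = 0 := hx
        rw [map_eq_zero_iff _ hinj] at this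
        rw [this]; exact P.zero_mem)
    have hX0 : (MvPolynomial.X 0 : MvPolynomial (Fin (s + 2)) ℝ) ∈ P := by
      change φ _ = 0
      simp [φ]
    have hQ0 : Q ≠ ⊥ := by
      rintro rfl
      rw [← hQP] at hX0
      have h1 : g (MvPolynomial.X 0) = 0 := hX0
      rw [map_eq_zero_iff _ hinj] at h1
      exact MvPolynomial.X_ne_zero _ h1
    have hmax : Q.IsMaximal := hQ.isMaximal_of_ne_bot hQ0
    have hPmax : P.IsMaximal := by
      rw [← hQP]
      exact Ideal.isMaximal_comap_of_isIntegral_of_isMaximal Q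
    have hX1 : (MvPolynomial.X 1 : MvPolynomial (Fin (s + 2)) ℝ) ∉ P := by
      intro h
      have h1 : φ (MvPolynomial.X 1) = 0 := h
      simp [φ] at h1
    obtain ⟨r, hr⟩ := hPmax.exists_inv hX1
    obtain ⟨i, hi, hi1⟩ := hr
    have h2 := congrArg (fun p => eval (0 : Fin (s + 2) → ℝ) (φ p)) hi1
    have h3 : φ i = 0 := hi
    have h4 : φ (MvPolynomial.X 1) = MvPolynomial.X 1 := by simp [φ]
    simp only [map_add, map_mul, h3, h4, map_one, eval_X, Pi.zero_apply, map_zero, mul_zero,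
      add_zero] at h2
    exact zero_ne_one h2

/-- package of the properties of irreducible curves that are used -/
def IrrC {n : ℕ} (S : Set (Fin n → ℝ)) : Prop :=
  (∀ f : (Fin n → ℝ) → ℝ, ContinuousOn f S → {x ∈ S | f x = 0}.Finite →
    ∃ (p : MvPolynomial (Fin n) ℝ) (E : Set (Fin n → ℝ)), E.Finite ∧
      ∀ x ∈ S, x ∉ E → ((0 < f x ↔ 0 < eval x p) ∧ eval x p ≠ 0)) ∧
  (∀ p : MvPolynomial (Fin n) ℝ, (∃ x ∈ S, eval x p ≠ 0) → {x ∈ S | eval x p = 0}.Finite) ∧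
  (∀ p h : MvPolynomial (Fin n) ℝ, {x ∈ S | eval x p = 0}.Finite → ∀ R ⊆ S, IsClosed R →
    (∀ x ∈ R, eval x p = 0 → eval x h = 0) →
    ∃ (N : ℕ) (W : MvPolynomial (Fin n) ℝ), (∀ x, 0 < eval x W) ∧
      ∀ x ∈ R, |eval x h| ^ N ≤ eval x W * |eval x p|)

lemma irrC_of_finite {n : ℕ} {S : Set (Fin n → ℝ)} (hS : S.Finite) : IrrC S := by
  refine ⟨fun f _ _ => ⟨1, S, hS, fun x hx hx' => absurd hx hx'⟩,
    fun p _ => hS.subset fun x hx => hx.1, fun p h _ R hR _ hz => ?_⟩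
  have hRf : R.Finite := hS.subset hR
  refine ⟨1, MvPolynomial.C (1 + ∑ x ∈ hRf.toFinset, |eval x h| / |eval x p|), fun x => ?_,
    fun x hx => ?_⟩
  · rw [eval_C]
    have : 0 ≤ ∑ x ∈ hRf.toFinset, |eval x h| / |eval x p| :=
      Finset.sum_nonneg fun x _ => by positivity
    linarith
  · rw [eval_C, pow_one]
    by_cases h0 : eval x p = 0
    · rw [hz x hx h0, h0]; simp
    · have h1 : |eval x h| / |eval x p| ≤ ∑ x ∈ hRf.toFinset, |eval x h| / |eval x p| :=
        Finset.single_le_sum (f := fun x => |eval x h| / |eval x p|)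
          (fun x _ => by positivity) (hRf.mem_toFinset.2 hx)
      have h2 : 0 < |eval x p| := abs_pos.2 h0
      have h3 : |eval x h| = |eval x h| / |eval x p| * |eval x p| := by field_simp
      rw [h3]
      exact mul_le_mul_of_nonneg_right (by linarith) h2.le

lemma irrC_of_PD {n : ℕ} {S : Set (Fin n → ℝ)} {A : Type*} [CommRing A] [Algebra ℝ A]
    [Algebra ℝ[X] A] [IsScalarTower ℝ ℝ[X] A] [Module.Finite ℝ[X] A] [IsDomain A]
    [Module.IsTorsionFree ℝ[X] A] (D : PD S A) (hS : S.Infinite) : IrrC S := by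
  have hfinite : ∀ q : (Fin n → ℝ) → Prop, {x : S | q x.1}.Finite ↔ {x ∈ S | q x}.Finite := by
    intro q
    have : {x ∈ S | q x} = Subtype.val '' {x : S | q x.1} := by
      ext x; simp [and_comm]
    rw [this, Set.finite_image_iff Subtype.val_injective.injOn]
  have hne : ∀ p : MvPolynomial (Fin n) ℝ, {x ∈ S | eval x p = 0}.Finite → D.π p ≠ 0 := by
    intro p hp h0
    apply hS
    refine hp.subset fun x hx => ⟨hx, ?_⟩
    have := D.ev_π ⟨x, hx⟩ p
    rw [h0, map_zero] at this
    exact this.symm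
  refine ⟨?_, ?_, ?_⟩
  · intro f hf hz
    obtain ⟨c, hc, E, hE, h⟩ := D.good_cont (fun x => f x.1)
      (continuousOn_iff_continuous_domRestrict.1 hf) ((hfinite fun x => f x = 0).2 hz)
    obtain ⟨p, rfl⟩ := D.surj c
    refine ⟨p, Subtype.val '' (E ∪ {x | D.ev x (D.π p) = 0}),
      (hE.union (D.zeros_finite hc)).image _, fun x hx hxE => ?_⟩
    have h1 : (⟨x, hx⟩ : S) ∉ E ∪ {x | D.ev x (D.π p) = 0} := fun h => hxE ⟨_, h, rfl⟩
    rw [Set.mem_union, not_or] at h1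
    have h2 := h _ h1.1
    have h3 : D.ev ⟨x, hx⟩ (D.π p) ≠ 0 := h1.2
    rw [D.ev_π] at h2 h3
    exact ⟨h2, h3⟩
  · rintro p ⟨x, hx, hxp⟩
    rw [← hfinite fun x => eval x p = 0]
    have : D.π p ≠ 0 := by
      intro h0
      apply hxp
      have := D.ev_π ⟨x, hx⟩ p
      rw [h0, map_zero] at this
      exact this.symm
    have := D.zeros_finite this
    simpa only [D.ev_π] using this
  · intro p h hp R hRS hRc hz
    obtain ⟨N, w, hw⟩ := D.loj (h := D.π h) (hne p hp) (R := Subtype.val ⁻¹' R)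
      (hRc.preimage continuous_subtype_val) (fun x hx => by
        rw [D.ev_π, D.ev_π]; exact hz x.1 hx)
    obtain ⟨W, rfl⟩ := D.surj w
    refine ⟨N, 1 + W ^ 2, fun x => ?_, fun x hx => ?_⟩
    · simp only [map_add, map_one, map_pow]; positivity
    · have := hw ⟨x, hRS hx⟩ hx
      rw [D.ev_π, D.ev_π, D.ev_π] at this
      refine this.trans (mul_le_mul_of_nonneg_right ?_ (abs_nonneg _))
      simp only [map_add, map_one, map_pow]
      nlinarith [sq_nonneg (eval x W - 1)]

/-- the zero set of a prime ideal comes with evaluation data -/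
noncomputable def pdOf {n : ℕ} (P : Ideal (MvPolynomial (Fin n) ℝ)) :
    PD {x | ∀ p ∈ P, eval x p = 0} (MvPolynomial (Fin n) ℝ ⧸ P) where
  π := Ideal.Quotient.mkₐ ℝ P
  surj := Ideal.Quotient.mkₐ_surjective ℝ P
  ev x := Ideal.Quotient.liftₐ P (MvPolynomial.aeval x.1)
    (fun p hp => by simpa [aeval_eq_eval] using x.2 p hp)
  ev_π x p := by simp
  lift φ := by
    intro p hp
    have : (MvPolynomial.aeval (R := ℝ) fun i => φ (Ideal.Quotient.mkₐ ℝ P (MvPolynomial.X i))) =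
        φ.comp (Ideal.Quotient.mkₐ ℝ P) := by
      apply MvPolynomial.algHom_ext
      intro i
      simp
    have h2 := DFunLike.congr_fun this p
    rw [MvPolynomial.aeval_eq_eval] at h2
    refine Eq.trans h2 ?_
    rw [AlgHom.comp_apply]
    have : Ideal.Quotient.mkₐ ℝ P p = 0 := Ideal.Quotient.eq_zero_iff_mem.2 hp
    rw [this, map_zero]

lemma irrC_aux {n : ℕ} {S : Set (Fin n → ℝ)} {A : Type*} [CommRing A] [Algebra ℝ A] [IsDomain A]
    [Algebra.FiniteType ℝ A] [Ring.KrullDimLE 1 A] (D : PD S A) : IrrC S := by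
  by_cases hS : S.Finite
  · exact irrC_of_finite hS
  rcases noether_curve A with h | ⟨g, hinj, hfin⟩
  · exfalso
    apply hS
    let : Algebra ℝ[X] A := (Polynomial.aeval (R := ℝ) (0 : A)).toRingHom.toAlgebra
    have hmap : ∀ q : ℝ[X], algebraMap ℝ[X] A q = Polynomial.aeval (R := ℝ) (0 : A) q :=
      fun q => rfl
    have : IsScalarTower ℝ ℝ[X] A := IsScalarTower.of_algebraMap_eq fun r => by
      rw [hmap]; simp
    have : Module.Finite ℝ[X] A := Module.Finite.of_restrictScalars_finite ℝ ℝ[X] A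
    have h1 := D.fiber_finite 0
    have h2 : {x : S | D.τ x = 0} = Set.univ := by
      ext x
      simp only [Set.mem_ofPred_eq, Set.mem_univ, iff_true]
      rw [PD.τ, hmap]; simp
    rw [h2, Set.finite_univ_iff] at h1
    exact Set.toFinite S
  · let : Algebra ℝ[X] A := g.toRingHom.toAlgebra
    have hmap : ∀ q : ℝ[X], algebraMap ℝ[X] A q = g q := fun q => rfl
    have : IsScalarTower ℝ ℝ[X] A := IsScalarTower.of_algebraMap_eq fun r => by
      rw [hmap, AlgHom.commutes]
    have : Module.Finite ℝ[X] A := hfin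
    have : Module.IsTorsionFree ℝ[X] A :=
      Module.isTorsionFree_iff_algebraMap_injective.2 hinj
    exact irrC_of_PD D hS

lemma irrC_prime {n : ℕ} (P : Ideal (MvPolynomial (Fin n) ℝ)) [P.IsPrime]
    (h : ringKrullDim (MvPolynomial (Fin n) ℝ ⧸ P) ≤ 1) :
    IrrC {x | ∀ p ∈ P, eval x p = 0} := by
  have : Ring.KrullDimLE 1 (MvPolynomial (Fin n) ℝ ⧸ P) := Ring.krullDimLE_iff.2 h
  exact irrC_aux (pdOf P)


lemma irredundant {α ι : Type*} (S : ι → Set α) (s : Finset ι) :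
    ∃ t ⊆ s, (⋃ i ∈ t, S i) = (⋃ i ∈ s, S i) ∧
      ∀ i ∈ t, ∃ x ∈ S i, ∀ j ∈ t, j ≠ i → x ∉ S j := by
  classical
  induction s using Finset.strongInduction with
  | H s ih =>
    by_cases h : ∀ i ∈ s, ∃ x ∈ S i, ∀ j ∈ s, j ≠ i → x ∉ S j
    · exact ⟨s, subset_rfl, rfl, h⟩
    · push Not at h
      obtain ⟨i, hi, h⟩ := h
      obtain ⟨t, ht, htU, htm⟩ := ih (s.erase i) (Finset.erase_ssubset hi)
      refine ⟨t, ht.trans (Finset.erase_subset _ _), ?_, htm⟩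
      rw [htU]
      ext x
      simp only [Set.mem_iUnion, Finset.mem_erase]
      constructor
      · rintro ⟨j, ⟨_, hj⟩, hx⟩
        exact ⟨j, hj, hx⟩
      · rintro ⟨j, hj, hx⟩
        by_cases hji : j = i
        · subst hji
          obtain ⟨k, hk, hkj, hxk⟩ := h x hx
          exact ⟨k, ⟨hkj, hk⟩, hxk⟩
        · exact ⟨j, ⟨hji, hj⟩, hx⟩

/-- squared distance to a point -/
noncomputable def sqd {n : ℕ} (e : Fin n → ℝ) : MvPolynomial (Fin n) ℝ :=
  ∑ i, (MvPolynomial.X i - MvPolynomial.C (e i)) ^ 2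

lemma sqd_nonneg {n : ℕ} (e x : Fin n → ℝ) : 0 ≤ eval x (sqd e) := by
  simp only [sqd, map_sum, map_pow]
  exact Finset.sum_nonneg fun i _ => sq_nonneg _

lemma sqd_eq_zero {n : ℕ} (e x : Fin n → ℝ) : eval x (sqd e) = 0 ↔ x = e := by
  simp only [sqd, map_sum, map_pow]
  rw [Finset.sum_eq_zero_iff_of_nonneg fun i _ => sq_nonneg _]
  simp only [map_sub, eval_X, eval_C, Finset.mem_univ, true_imp_iff, sq_eq_zero_iff, sub_eq_zero]
  exact ⟨fun h => funext h, fun h i => by rw [h]⟩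

lemma exists_interp {n : ℕ} (E : Finset (Fin n → ℝ)) (f : (Fin n → ℝ) → ℝ) :
    ∃ s : MvPolynomial (Fin n) ℝ, ∀ e ∈ E, eval e s = f e := by
  classical
  refine ⟨∑ e ∈ E, MvPolynomial.C (f e / eval e (∏ e' ∈ E.erase e, sqd e')) *
    ∏ e' ∈ E.erase e, sqd e', fun e he => ?_⟩
  rw [map_sum, Finset.sum_eq_single e]
  · rw [map_mul, eval_C]
    apply div_mul_cancel₀
    rw [map_prod, Finset.prod_ne_zero_iff]
    intro e' he'
    rw [Ne, sqd_eq_zero]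
    exact (Finset.ne_of_mem_erase he').symm
  · intro b hb hbe
    have hz : eval e (∏ e' ∈ E.erase b, sqd e') = 0 := by
      rw [map_prod]
      exact Finset.prod_eq_zero (Finset.mem_erase.2 ⟨hbe.symm, he⟩) ((sqd_eq_zero e e).2 rfl)
    rw [map_mul, hz, mul_zero]
  · intro h; exact absurd he h

lemma sign_eq_of_mul_pos {a b : ℝ} (h : 0 < a * b) : Real.sign a = Real.sign b := by
  rcases pos_and_pos_or_neg_and_neg_of_mul_pos h with ⟨h1, h2⟩ | ⟨h1, h2⟩
  · rw [Real.sign_of_pos h1, Real.sign_of_pos h2]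
  · rw [Real.sign_of_neg h1, Real.sign_of_neg h2]

lemma core {n : ℕ} {ι : Type*} (t : Finset ι) (S : ι → Set (Fin n → ℝ))
    (hI : ∀ i ∈ t, IrrC (S i)) (q : ι → MvPolynomial (Fin n) ℝ)
    (hq0 : ∀ i x, 0 ≤ eval x (q i)) (hqS : ∀ i x, eval x (q i) = 0 ↔ x ∈ S i)
    (hmin : ∀ i ∈ t, ∃ x ∈ S i, ∀ j ∈ t, j ≠ i → x ∉ S j)
    (f : (Fin n → ℝ) → ℝ) (hf : ∀ i ∈ t, ContinuousOn f (S i))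
    (h : MvPolynomial (Fin n) ℝ) (h0 : ∀ x, 0 ≤ eval x h)
    (hZ : ∀ i ∈ t, ∀ x ∈ S i, (eval x h = 0 ↔ f x = 0)) :
    ∃ p : MvPolynomial (Fin n) ℝ, ∀ i ∈ t, ∀ x ∈ S i, Real.sign (f x) = Real.sign (eval x p) := by
  classical
  let t' := t.filter fun i => ∃ x ∈ S i, f x ≠ 0
  have ht' : ∀ i ∈ t', i ∈ t := fun i hi => (Finset.mem_filter.1 hi).1
  have hfz : ∀ i ∈ t', {x ∈ S i | f x = 0}.Finite := by
    intro i hi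
    obtain ⟨hit, x, hx, hfx⟩ := Finset.mem_filter.1 hi
    refine ((hI i hit).2.1 h ⟨x, hx, fun hh => hfx ((hZ i hit x hx).1 hh)⟩).subset ?_
    rintro z ⟨hz, hz0⟩
    exact ⟨hz, (hZ i hit z hz).2 hz0⟩
  have hA : ∀ i : ι, ∃ (p : MvPolynomial (Fin n) ℝ) (E : Set (Fin n → ℝ)), i ∈ t' → (E.Finite ∧
      ∀ x ∈ S i, x ∉ E → ((0 < f x ↔ 0 < eval x p) ∧ eval x p ≠ 0)) := by
    intro i
    by_cases hi : i ∈ t'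
    · obtain ⟨p, E, hE⟩ := (hI i (ht' i hi)).1 f (hf i (ht' i hi)) (hfz i hi)
      exact ⟨p, E, fun _ => hE⟩
    · exact ⟨0, ∅, fun hh => absurd hh hi⟩
  choose p E hpE using hA
  let k : ι → MvPolynomial (Fin n) ℝ := fun i => ∏ j ∈ t.erase i, q j
  have hk0 : ∀ i x, 0 ≤ eval x (k i) := fun i x => by
    simp only [k, map_prod]
    exact Finset.prod_nonneg fun j _ => hq0 j x
  have hkz : ∀ i ∈ t', {x ∈ S i | eval x (k i) = 0}.Finite := by
    intro i hi
    refine (hI i (ht' i hi)).2.1 (k i) ?_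
    obtain ⟨x, hx, hxj⟩ := hmin i (ht' i hi)
    refine ⟨x, hx, ?_⟩
    simp only [k, map_prod]
    rw [Finset.prod_ne_zero_iff]
    intro j hj
    rw [Ne, hqS]
    exact hxj j (Finset.mem_of_mem_erase hj) (Finset.ne_of_mem_erase hj)
  have hkj : ∀ i ∈ t, ∀ j, j ≠ i → ∀ x ∈ S i, eval x (k j) = 0 := by
    intro i hi j hji x hx
    simp only [k, map_prod]
    exact Finset.prod_eq_zero (Finset.mem_erase.2 ⟨hji.symm, hi⟩) ((hqS i x).2 hx)
  let p0 := ∑ i ∈ t', p i * k i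
  have hp0 : ∀ i ∈ t', ∀ x ∈ S i, eval x p0 = eval x (p i) * eval x (k i) := by
    intro i hi x hx
    simp only [p0, map_sum, map_mul]
    rw [Finset.sum_eq_single i]
    · intro j _ hji
      rw [hkj i (ht' i hi) j hji x hx, mul_zero]
    · intro hh; exact absurd hi hh
  have hEf : (⋃ i ∈ t', (E i ∪ ({x ∈ S i | eval x (k i) = 0} ∪ {x ∈ S i | f x = 0}))).Finite :=
    Set.Finite.biUnion (Finset.finite_toSet _) fun i hi =>
      (hpE i hi).1.union ((hkz i hi).union (hfz i hi))
  let F := hEf.toFinset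
  have hF0 : ∀ i ∈ t', ∀ x ∈ S i, x ∉ F → 0 < eval x p0 * f x := by
    intro i hi x hx hxF
    have hx1 : x ∉ E i ∪ ({x ∈ S i | eval x (k i) = 0} ∪ {x ∈ S i | f x = 0}) := by
      intro hh
      apply hxF
      rw [Set.Finite.mem_toFinset]
      simp only [Set.mem_iUnion]
      exact ⟨i, hi, hh⟩
    rw [Set.mem_union, Set.mem_union, not_or, not_or] at hx1
    obtain ⟨h1, h2, h3⟩ := hx1
    have h2 : eval x (k i) ≠ 0 := fun hh => h2 ⟨hx, hh⟩
    have h3 : f x ≠ 0 := fun hh => h3 ⟨hx, hh⟩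
    have h2' : 0 < eval x (k i) := lt_of_le_of_ne (hk0 i x) h2.symm
    obtain ⟨h4, h5⟩ := (hpE i hi).2 x hx h1
    have h6 : 0 < eval x (p i) * f x := by
      rcases lt_or_gt_of_ne h3 with h | h
      · refine mul_pos_of_neg_of_neg (lt_of_le_of_ne ?_ h5) h
        by_contra hc
        push Not at hc
        linarith [h4.2 hc]
      · exact mul_pos (h4.1 h) h
    rw [hp0 i hi x hx]
    have := mul_pos h6 h2'
    linarith
  let P := p0 * ∏ e ∈ F, sqd e
  have hP0 : ∀ i ∈ t', ∀ x ∈ S i, x ∉ F → 0 < eval x P * f x := by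
    intro i hi x hx hxF
    have h1 := hF0 i hi x hx hxF
    have h2 : 0 < eval x (∏ e ∈ F, sqd e) := by
      rw [map_prod]
      refine Finset.prod_pos fun e he => lt_of_le_of_ne (sqd_nonneg e x) (Ne.symm ?_)
      rw [Ne, sqd_eq_zero]
      rintro rfl
      exact hxF he
    simp only [P, map_mul] at h2 ⊢
    have := mul_pos h1 h2
    linarith
  have hPF : ∀ x ∈ F, eval x P = 0 := by
    intro x hx
    simp only [P, map_mul, map_prod]
    rw [Finset.prod_eq_zero hx ((sqd_eq_zero x x).2 rfl), mul_zero]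
  have hPz : ∀ i ∈ t', ∀ x ∈ S i, eval x P = 0 → x ∈ F := by
    intro i hi x hx hh
    by_contra hc
    have := hP0 i hi x hx hc
    rw [hh, zero_mul] at this
    exact lt_irrefl _ this
  obtain ⟨s, hs⟩ := exists_interp F f
  have hL : ∀ i : ι, ∃ (N : ℕ) (W : MvPolynomial (Fin n) ℝ), i ∈ t' → ((∀ x, 0 < eval x W) ∧
      ∀ x ∈ S i, eval x s * f x ≤ 0 → eval x h ^ N ≤ eval x W * |eval x P|) := by
    intro i
    by_cases hi : i ∈ t'
    · have hSc : IsClosed (S i) := by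
        have : S i = {x | eval x (q i) = 0} := by ext x; exact (hqS i x).symm
        rw [this]
        exact isClosed_eq (MvPolynomial.continuous_eval _) continuous_const
      have hRc : IsClosed (S i ∩ (fun x => eval x s * f x) ⁻¹' Set.Iic 0) :=
        ContinuousOn.preimage_isClosed_of_isClosed
          ((MvPolynomial.continuous_eval s).continuousOn.mul (hf i (ht' i hi))) hSc isClosed_Iic
      obtain ⟨N, W, hW, hN⟩ := (hI i (ht' i hi)).2.2 P h
        ((Finset.finite_toSet F).subset fun x hx => hPz i hi x hx.1 hx.2) _ Set.inter_subset_left hRc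
        (by
          rintro x ⟨hx, hx2⟩ hx0
          have h1 : eval x s * f x ≤ 0 := hx2
          rw [hs x (hPz i hi x hx hx0)] at h1
          rw [hZ i (ht' i hi) x hx]
          nlinarith [mul_self_nonneg (f x), mul_self_eq_zero (a := f x)])
      refine ⟨N, W, fun _ => ⟨hW, fun x hx hx2 => ?_⟩⟩
      have := hN x ⟨hx, hx2⟩
      rwa [abs_of_nonneg (h0 x)] at this
    · exact ⟨0, 0, fun hh => absurd hh hi⟩
  choose N W hNW using hL
  let M := ∑ i ∈ t', N i
  let w := (1 + h) ^ M * ∑ i ∈ t', W i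
  have hw : ∀ i ∈ t', ∀ x ∈ S i, 0 < eval x w ∧
      (eval x s * f x ≤ 0 → eval x h ^ M ≤ eval x w * |eval x P|) := by
    intro i hi x hx
    have hh := h0 x
    have h1 : 1 ≤ (1 + eval x h) ^ M := one_le_pow₀ (by linarith)
    have h2 : eval x (W i) ≤ ∑ i ∈ t', eval x (W i) :=
      Finset.single_le_sum (f := fun i => eval x (W i))
        (fun j hj => ((hNW j hj).1 x).le) hi
    have h3 := (hNW i hi).1 x
    have h4 : eval x w = (1 + eval x h) ^ M * ∑ i ∈ t', eval x (W i) := by simp [w]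
    rw [h4]
    refine ⟨mul_pos (by linarith) (by linarith), fun hsf => ?_⟩
    have h5 := (hNW i hi).2 x hx hsf
    have hNM : N i ≤ M := Finset.single_le_sum (f := N) (fun j _ => Nat.zero_le _) hi
    have h6 : eval x h ^ (M - N i) ≤ (1 + eval x h) ^ M :=
      (pow_le_pow_left₀ hh (by linarith) _).trans (pow_le_pow_right₀ (by linarith) (by omega))
    calc eval x h ^ M = eval x h ^ (M - N i) * eval x h ^ N i := by
          rw [← pow_add]; congr 1; omega
      _ ≤ (1 + eval x h) ^ M * (eval x (W i) * |eval x P|) := by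
          apply mul_le_mul h6 h5 (by positivity) (by positivity)
      _ ≤ (1 + eval x h) ^ M * ((∑ i ∈ t', eval x (W i)) * |eval x P|) := by
          gcongr
      _ = _ := by ring
  refine ⟨h * (P * w * (1 + s ^ 2) + s * h ^ M), fun i hi x hx => ?_⟩
  by_cases hfx : f x = 0
  · rw [hfx, map_mul, (hZ i hi x hx).2 hfx, zero_mul]
  · have hi' : i ∈ t' := Finset.mem_filter.2 ⟨hi, x, hx, hfx⟩
    have hh : 0 < eval x h := lt_of_le_of_ne (h0 x) fun hh => hfx ((hZ i hi x hx).1 hh.symm)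
    obtain ⟨hw0, hw1⟩ := hw i hi' x hx
    apply sign_eq_of_mul_pos
    simp only [map_mul, map_add, map_pow, map_one]
    suffices hsuf : 0 < (eval x P * eval x w * (1 + eval x s ^ 2) + eval x s * eval x h ^ M) * f x by
      have := mul_pos hh hsuf
      linarith
    have hhM : 0 < eval x h ^ M := by positivity
    by_cases hsf : eval x s * f x ≤ 0
    · have hxF : x ∉ F := by
        intro hxF
        rw [hs x hxF] at hsf
        exact absurd (mul_self_pos.2 hfx) (not_lt.2 hsf)
      have hPf := hP0 i hi' x hx hxF
      have hle := hw1 hsf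
      have hPabs : |eval x P| * |f x| = eval x P * f x := by
        rw [← abs_mul, abs_of_pos hPf]
      have hsabs : |eval x s| * |f x| = -(eval x s * f x) := by
        rw [← abs_mul, abs_of_nonpos hsf]
      have h7 : |eval x s| * |f x| * eval x h ^ M ≤
          |eval x s| * |f x| * (eval x w * |eval x P|) :=
        mul_le_mul_of_nonneg_left hle (by positivity)
      have h8 : |eval x s| * |f x| * (eval x w * |eval x P|) =
          |eval x s| * (eval x w * (eval x P * f x)) := by rw [← hPabs]; ring
      have h9 : 0 < eval x w * (eval x P * f x) := mul_pos hw0 hPf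
      rw [h8, hsabs] at h7
      have h10 : 0 < (1 + eval x s ^ 2 - |eval x s|) * (eval x w * (eval x P * f x)) := by
        refine mul_pos ?_ h9
        rw [← sq_abs]
        nlinarith [sq_nonneg (|eval x s| - 1)]
      nlinarith
    · push Not at hsf
      have hPf : 0 ≤ eval x P * f x := by
        by_cases hxF : x ∈ F
        · rw [hPF x hxF, zero_mul]
        · exact (hP0 i hi' x hx hxF).le
      have h1 : 0 ≤ eval x P * f x * (eval x w * (1 + eval x s ^ 2)) := by positivity
      have h2 := mul_pos hsf hhM
      nlinarith

end helpers

/-- on a one-dimensional real algebraic set, the sign of a continuous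
semi-algebraic function `f` is the sign of a polynomial function iff `Z(f)` is Zariski
closed. -/
theorem sign_eq_sign_poly_iff_dim_one {n : ℕ} (X : Set (Fin n → ℝ))
    (hX : IsRealAlgebraicSet X) (hdim : algDim X = (1 : WithBot ℕ∞))
    (f : (Fin n → ℝ) → ℝ) (hfc : ContinuousOn f X) (hfsa : IsSemialgebraicFnOn X f) :
    (∃ p : MvPolynomial (Fin n) ℝ,
        ∀ x ∈ X, Real.sign (f x) = Real.sign (MvPolynomial.eval x p)) ↔
      IsZariskiClosedIn X {x ∈ X | f x = 0} := by
  constructor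
  · rintro ⟨p, hp⟩
    obtain ⟨k, q, rfl⟩ := hX
    refine ⟨⟨k + 1, Fin.cons p q, ?_⟩, fun x hx => hx.1⟩
    ext x
    simp only [Set.mem_ofPred_eq, Fin.forall_fin_succ, Fin.cons_zero, Fin.cons_succ]
    constructor
    · rintro ⟨hx, hfx⟩
      have := hp x hx
      rw [hfx, Real.sign_zero, eq_comm, Real.sign_eq_zero_iff] at this
      exact ⟨this, hx⟩
    · rintro ⟨hpx, hx⟩
      have := hp x hx
      rw [hpx, Real.sign_zero, Real.sign_eq_zero_iff] at this
      exact ⟨hx, this⟩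
  · rintro ⟨⟨m, r, hr⟩, -⟩
    obtain ⟨k, qX, hqX⟩ := hX
    set I := vanishingIdealOf X with hI
    have hfin : I.minimalPrimes.Finite := Ideal.finite_minimalPrimes_of_isNoetherianRing _ I
    let V : Ideal (MvPolynomial (Fin n) ℝ) → Set (Fin n → ℝ) :=
      fun P => {x | ∀ p ∈ P, eval x p = 0}
    have hXV : X = ⋃ P ∈ hfin.toFinset, V P := by
      ext x
      simp only [Set.mem_iUnion, Set.Finite.mem_toFinset]
      constructor
      · intro hx
        have hprime : (RingHom.ker (eval x)).IsPrime := RingHom.ker_isPrime _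
        have hle : I ≤ RingHom.ker (eval x) := fun p hp => hp x hx
        obtain ⟨P, hP, hPx⟩ := Ideal.exists_minimalPrimes_le hle
        exact ⟨P, hP, fun p hp => hPx hp⟩
      · rintro ⟨P, hP, hx⟩
        rw [hqX]
        intro i
        refine hx _ (hP.1.2 ?_)
        intro z hz
        rw [hqX] at hz
        exact hz i
    have hV : ∀ P ∈ hfin.toFinset, IrrC (V P) := by
      intro P hP
      rw [Set.Finite.mem_toFinset] at hP
      have hPp : P.IsPrime := hP.1.1
      refine irrC_prime P ?_
      have h1 : ringKrullDim (MvPolynomial (Fin n) ℝ ⧸ P) ≤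
          ringKrullDim (MvPolynomial (Fin n) ℝ ⧸ I) :=
        ringKrullDim_le_of_surjective (Ideal.Quotient.factor hP.1.2)
          (Ideal.Quotient.factor_surjective hP.1.2)
      exact h1.trans (le_of_eq hdim)
    have hq : ∀ P : Ideal (MvPolynomial (Fin n) ℝ), ∃ q : MvPolynomial (Fin n) ℝ,
        (∀ x, 0 ≤ eval x q) ∧ ∀ x, eval x q = 0 ↔ x ∈ V P := by
      intro P
      obtain ⟨G, hG⟩ := IsNoetherian.noetherian P
      refine ⟨∑ g ∈ G, g ^ 2, fun x => ?_, fun x => ?_⟩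
      · simp only [map_sum, map_pow]
        exact Finset.sum_nonneg fun i _ => sq_nonneg _
      · simp only [map_sum, map_pow]
        rw [Finset.sum_eq_zero_iff_of_nonneg fun i _ => sq_nonneg _]
        simp only [sq_eq_zero_iff]
        constructor
        · intro hx p hp
          have hle : P ≤ RingHom.ker (eval x) := by
            rw [← hG]
            exact Submodule.span_le.2 fun g hg => hx g hg
          exact hle hp
        · intro hx g hg
          refine hx g ?_
          rw [← hG]
          exact Submodule.subset_span hg
    choose q hq0 hqV using hq
    obtain ⟨t, ht, htU, htm⟩ := irredundant V hfin.toFinset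
    rw [← htU] at hXV
    have hmem : ∀ i ∈ t, ∀ x ∈ V i, x ∈ X := by
      intro i hi x hx
      rw [hXV]
      simp only [Set.mem_iUnion]
      exact ⟨i, hi, hx⟩
    obtain ⟨p, hp⟩ := core t V (fun i hi => hV i (ht hi)) q hq0 hqV htm f
      (fun i hi => hfc.mono (hmem i hi)) (∑ j, r j ^ 2)
      (fun x => by
        simp only [map_sum, map_pow]
        exact Finset.sum_nonneg fun i _ => sq_nonneg _)
      (fun i hi x hx => by
        have h1 : x ∈ {x | x ∈ X ∧ f x = 0} ↔ x ∈ {x | ∀ i, eval x (r i) = 0} := by rw [hr]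
        simp only [Set.mem_ofPred_eq, hmem i hi x hx, true_and] at h1
        rw [h1]
        simp only [map_sum, map_pow]
        rw [Finset.sum_eq_zero_iff_of_nonneg fun i _ => sq_nonneg _]
        simp)
    refine ⟨p, fun x hx => ?_⟩
    rw [hXV] at hx
    simp only [Set.mem_iUnion] at hx
    obtain ⟨i, hi, hx⟩ := hx
    exact hp i hi x hx
end

section
/- Let X ⊆ ℝⁿ be an irreducible real algebraic set of dimension 1 and let f be a regulous function on X. Then there exist polynomial functions h₁, h₂ on X such that for every x ∈ X, sign(f)(x) = sign(h₁)(x) + sign(h₂)(x); in particular the sign of any regulous function on X is a sum of at most 2 signs of polynomial functions on X. -/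
open MvPolynomial Set

lemma aux_prime {n : ℕ} {X : Set (Fin n → ℝ)} (hX : IsIrreducibleAlgSet X)
    {a b : MvPolynomial (Fin n) ℝ} (hab : a * b ∈ vanishingIdealOf X)
    (ha : a ∉ vanishingIdealOf X) : b ∈ vanishingIdealOf X := by
  obtain ⟨⟨k, p, hp⟩, hirr⟩ := hX
  have key : ∀ c : MvPolynomial (Fin n) ℝ, IsZariskiClosedIn X {x ∈ X | eval x c = 0} := by
    intro c
    refine ⟨⟨k + 1, Fin.cons c p, ?_⟩, fun x hx => hx.1⟩
    ext x
    simp only [Set.mem_ofPred_eq, Fin.forall_fin_succ, Fin.cons_zero, Fin.cons_succ]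
    constructor
    · rintro ⟨h1, h2⟩
      rw [hp] at h1
      exact ⟨h2, h1⟩
    · rintro ⟨h1, h2⟩
      refine ⟨?_, h1⟩
      rw [hp]; exact h2
  have hor := hirr _ _ (key a) (key b) (by
    ext x
    constructor
    · intro hx
      have := hab x hx
      rw [map_mul, mul_eq_zero] at this
      rcases this with h | h
      · exact Or.inl ⟨hx, h⟩
      · exact Or.inr ⟨hx, h⟩
    · rintro (h | h)
      · exact h.1
      · exact h.1)
  rcases hor with h | h
  · exfalso
    apply ha
    intro x hx
    rw [← h] at hx
    exact hx.2
  · intro x hx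
    rw [← h] at hx
    exact hx.2

lemma aux_integral {A : Type*} [CommRing A] [Algebra ℝ A] [Algebra.FiniteType ℝ A]
    (hdim : ringKrullDim A ≤ 1) (r : A) (hr : r ∈ nonZeroDivisors A) (y : A) :
    ∃ u : Polynomial ℝ, u ≠ 0 ∧ r ∣ Polynomial.aeval y u := by
  have h1 := ringKrullDim_quotient_succ_le_of_nonZeroDivisor hr
  have h2 : Ring.KrullDimLE 0 (A ⧸ Ideal.span {r}) := by
    rw [Ring.krullDimLE_iff]
    have := h1.trans hdim
    have h3 := ENat.WithBot.add_one_le_natCast_iff (m := 1).mp (by simpa using this)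
    exact ENat.WithBot.lt_add_one_iff.mp (by simpa using h3)
  have : IsNoetherianRing A := Algebra.FiniteType.isNoetherianRing ℝ A
  have : IsArtinianRing (A ⧸ Ideal.span {r}) := isArtinianRing_iff_krullDimLE_zero.mpr h2
  have : Module.Finite ℝ (A ⧸ Ideal.span {r}) := by
    exact Module.finite_of_isArtinianRing ℝ _
  obtain ⟨u, hu, hu2⟩ := (Algebra.IsIntegral.isIntegral (R := ℝ)
    (Ideal.Quotient.mk (Ideal.span {r}) y))
  refine ⟨u, hu.ne_zero, ?_⟩
  rw [← Ideal.mem_span_singleton, ← Ideal.Quotient.eq_zero_iff_mem, ← hu2]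
  exact (Polynomial.aeval_algHom_apply (Ideal.Quotient.mkₐ ℝ (Ideal.span {r})) y u).symm

lemma aux_coord {n : ℕ} {X : Set (Fin n → ℝ)} (hX : IsIrreducibleAlgSet X)
    (hdim : algDim X = (1 : WithBot ℕ∞)) (P : MvPolynomial (Fin n) ℝ)
    (hP : P ∉ vanishingIdealOf X) (i : Fin n) :
    ∃ (u : Polynomial ℝ) (G : MvPolynomial (Fin n) ℝ), u ≠ 0 ∧
      ∀ x ∈ X, u.eval (x i) = eval x P * eval x G := by
  obtain ⟨u, hu, hd⟩ := aux_integral (A := MvPolynomial (Fin n) ℝ ⧸ vanishingIdealOf X)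
    (le_of_eq hdim) (Ideal.Quotient.mk _ P) (by
      rw [mem_nonZeroDivisors_iff_right]
      intro z hz
      obtain ⟨z, rfl⟩ := Ideal.Quotient.mk_surjective z
      rw [← map_mul, Ideal.Quotient.eq_zero_iff_mem, mul_comm] at hz
      exact Ideal.Quotient.eq_zero_iff_mem.mpr (aux_prime hX hz hP)) (Ideal.Quotient.mk _ (MvPolynomial.X i))
  obtain ⟨z, hz⟩ := hd
  obtain ⟨G, rfl⟩ := Ideal.Quotient.mk_surjective z
  refine ⟨u, G, hu, fun x hx => ?_⟩
  have h1 : Polynomial.aeval (Ideal.Quotient.mk (vanishingIdealOf X) (MvPolynomial.X i)) u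
      = Ideal.Quotient.mk (vanishingIdealOf X)
        (Polynomial.aeval (MvPolynomial.X i : MvPolynomial (Fin n) ℝ) u) :=
    (Polynomial.aeval_algHom_apply (Ideal.Quotient.mkₐ ℝ (vanishingIdealOf X)) _ _)
  rw [h1, ← map_mul, Ideal.Quotient.eq] at hz
  have := hz x hx
  rw [map_sub, map_mul, sub_eq_zero] at this
  rw [← this]
  have h2 := Polynomial.aeval_algHom_apply (MvPolynomial.aeval x : MvPolynomial (Fin n) ℝ →ₐ[ℝ] ℝ)
    (MvPolynomial.X i) u
  simpa [MvPolynomial.aeval_eq_eval, Polynomial.aeval_def] using h2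

lemma aux_finite {n : ℕ} {X : Set (Fin n → ℝ)} (hX : IsIrreducibleAlgSet X)
    (hdim : algDim X = (1 : WithBot ℕ∞)) (P : MvPolynomial (Fin n) ℝ)
    (hP : P ∉ vanishingIdealOf X) : {x ∈ X | eval x P = 0}.Finite := by
  choose u G hu hG using aux_coord hX hdim P hP
  refine (Set.Finite.pi' (t := fun i => {t : ℝ | (u i).eval t = 0}) ?_).subset ?_
  · intro i
    exact Polynomial.finite_setOfPred_isRoot (hu i)
  · rintro x ⟨hx, h0⟩ i
    simp only [Set.mem_ofPred_eq]
    rw [hG i x hx, h0, zero_mul]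

lemma aux_limit (k : ℕ) : ∀ (P Q : Polynomial ℝ) (γ : ℝ → ℝ), Continuous γ →
    (∀ t, P.eval t = γ t * Q.eval t) → (∀ j < k, Q.coeff j = 0) →
    P.coeff k = γ 0 * Q.coeff k := by
  induction k with
  | zero =>
    intro P Q γ hγ h _
    have := h 0
    rwa [← Polynomial.coeff_zero_eq_eval_zero, ← Polynomial.coeff_zero_eq_eval_zero] at this
  | succ k ih =>
    intro P Q γ hγ h hQ
    have hQ0 := hQ 0 (Nat.succ_pos k)
    have hP0 : P.coeff 0 = 0 := by
      have := h 0
      rwa [← Polynomial.coeff_zero_eq_eval_zero, ← Polynomial.coeff_zero_eq_eval_zero, hQ0,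
        mul_zero] at this
    have eP : ∀ t, P.eval t = P.divX.eval t * t := fun t => by
      conv_lhs => rw [← P.divX_mul_X_add, hP0]
      simp
    have eQ : ∀ t, Q.eval t = Q.divX.eval t * t := fun t => by
      conv_lhs => rw [← Q.divX_mul_X_add, hQ0]
      simp
    have key : (fun t => P.divX.eval t) = fun t => γ t * Q.divX.eval t := by
      apply Continuous.ext_on (dense_compl_singleton (0 : ℝ)) (by fun_prop) (by fun_prop)
      intro t ht
      have := h t
      rw [eP, eQ, ← mul_assoc] at this
      exact mul_right_cancel₀ ht this
    have := ih P.divX Q.divX γ hγ (fun t => congrFun key t) (fun j hj => by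
      rw [Polynomial.coeff_divX]; exact hQ _ (by omega))
    rwa [Polynomial.coeff_divX, Polynomial.coeff_divX] at this

/-- The expansion of `p (x + t v)` in powers of `t`. -/
noncomputable def auxShift {n : ℕ} (v : Fin n → ℝ) (p : MvPolynomial (Fin n) ℝ) :
    Polynomial (MvPolynomial (Fin n) ℝ) :=
  MvPolynomial.eval₂ (Polynomial.C.comp MvPolynomial.C)
    (fun i => Polynomial.C (X i) + Polynomial.C (C (v i)) * Polynomial.X) p

lemma auxShift_eval {n : ℕ} (v : Fin n → ℝ) (p : MvPolynomial (Fin n) ℝ) (x : Fin n → ℝ) (t : ℝ) :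
    ((auxShift v p).map (eval x)).eval t = eval (x + t • v) p := by
  unfold auxShift
  induction p using MvPolynomial.induction_on with
  | C a => simp
  | add p q hp hq => simp [hp, hq]
  | mul_X p i hp =>
    rw [eval₂_mul, Polynomial.map_mul, Polynomial.eval_mul, hp]
    simp [mul_comm t]

lemma aux_rational {n : ℕ} {X : Set (Fin n → ℝ)} {f : (Fin n → ℝ) → ℝ} (hf : IsRegulousOn X f)
    (hne : X.Nonempty) :
    ∃ p q : MvPolynomial (Fin n) ℝ, q ∉ vanishingIdealOf X ∧
      ∀ x ∈ X, eval x p = f x * eval x q := by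
  classical
  obtain ⟨g, ⟨hg, U, ⟨-, k, d, hd⟩, ⟨u, hu⟩, p, q, hq, hpq⟩, hfg⟩ := hf
  have hu' : u ∉ {x | ∀ i, eval x (d i) = 0} := by
    rw [← hd]; exact fun h => h.2 hu
  simp only [Set.mem_ofPred_eq, not_forall] at hu'
  obtain ⟨i, hi⟩ := hu'
  have hall : ∀ x, eval x (p * d i) = g x * eval x (q * d i) := by
    intro x
    by_cases hx : x ∈ U
    · have := hq x hx
      rw [hpq x hx, map_mul, map_mul]
      field_simp
    · have : x ∈ {x | ∀ i, eval x (d i) = 0} := by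
        rw [← hd]; exact ⟨trivial, hx⟩
      rw [map_mul, map_mul, this i]; simp
  generalize hP : p * d i = P at hall
  have hQu : eval u (q * d i) ≠ 0 := by
    rw [map_mul]; exact mul_ne_zero (hq u hu) hi
  generalize q * d i = Q at hall hQu
  obtain ⟨x0, hx0⟩ := hne
  set v := u - x0 with hv
  have hex : ∃ k, (auxShift v Q).coeff k ∉ vanishingIdealOf X := by
    by_contra! hcon
    apply hQu
    have h1 := auxShift_eval v Q x0 1
    have h2 : (auxShift v Q).map (eval x0) = 0 := by
      ext j
      rw [Polynomial.coeff_map]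
      exact hcon j x0 hx0
    rw [h2] at h1
    simpa [hv] using h1.symm
  refine ⟨(auxShift v P).coeff (Nat.find hex), (auxShift v Q).coeff (Nat.find hex),
    Nat.find_spec hex, fun x hx => ?_⟩
  have := aux_limit (Nat.find hex) ((auxShift v P).map (eval x)) ((auxShift v Q).map (eval x))
    (fun t => g (x + t • v)) (by fun_prop) (fun t => by
      rw [auxShift_eval, auxShift_eval]; exact hall _) (fun j hj => by
      have := Nat.find_min hex hj
      rw [not_not] at this
      rw [Polynomial.coeff_map]
      exact this x hx)
  simpa [Polynomial.coeff_map, hfg x hx] using this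

/-- Squared distance to `a`. -/
noncomputable def auxSq {n : ℕ} (a : Fin n → ℝ) : MvPolynomial (Fin n) ℝ :=
  ∑ i, (X i - C (a i)) ^ 2

lemma auxSq_self {n : ℕ} (a : Fin n → ℝ) : eval a (auxSq a) = 0 := by
  simp [auxSq]

lemma auxSq_pos {n : ℕ} (a x : Fin n → ℝ) (h : x ≠ a) : 0 < eval x (auxSq a) := by
  obtain ⟨i, hi⟩ := Function.ne_iff.mp h
  simp only [auxSq, map_sum, map_pow, map_sub, eval_X, eval_C]
  exact Finset.sum_pos' (fun j _ => sq_nonneg _)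
    ⟨i, Finset.mem_univ _, by have := sub_ne_zero.mpr hi; positivity⟩

lemma aux_sign_pos_mul {a b : ℝ} (ha : 0 < a) : Real.sign (a * b) = Real.sign b := by
  rcases lt_trichotomy b 0 with h | h | h
  · rw [Real.sign_of_neg h, Real.sign_of_neg (mul_neg_of_pos_of_neg ha h)]
  · simp [h]
  · rw [Real.sign_of_pos h, Real.sign_of_pos (mul_pos ha h)]

lemma aux_caseA {n : ℕ} {X : Set (Fin n → ℝ)} (f : (Fin n → ℝ) → ℝ)
    (hN : {x ∈ X | f x ≠ 0}.Finite) :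
    ∃ h₁ h₂ : MvPolynomial (Fin n) ℝ,
      ∀ x ∈ X, Real.sign (f x) = Real.sign (eval x h₁) + Real.sign (eval x h₂) := by
  classical
  have key : ∀ S : Finset (Fin n → ℝ), ∃ h : MvPolynomial (Fin n) ℝ,
      ∀ x, (x ∈ S → Real.sign (eval x h) = 0) ∧ (x ∉ S → Real.sign (eval x h) = 1) := by
    intro S
    refine ⟨∏ a ∈ S, auxSq a, fun x => ⟨fun hx => ?_, fun hx => ?_⟩⟩
    · rw [Real.sign_eq_zero_iff, map_prod]
      exact Finset.prod_eq_zero hx (auxSq_self x)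
    · apply Real.sign_of_pos
      rw [map_prod]
      exact Finset.prod_pos fun a ha => auxSq_pos a x (by rintro rfl; exact hx ha)
  obtain ⟨h₁, H1⟩ := key (hN.toFinset.filter (fun x => f x < 0))
  obtain ⟨h₂, H2⟩ := key (hN.toFinset.filter (fun x => 0 < f x))
  refine ⟨h₁, -h₂, fun x hx => ?_⟩
  rw [map_neg, Real.sign_neg]
  rcases lt_trichotomy (f x) 0 with h | h | h
  · rw [Real.sign_of_neg h, (H1 x).1 (by simp [hx, h, h.ne]), (H2 x).2 (by simp [h.le])]
    simp
  · rw [h, (H1 x).2 (by simp [h]), (H2 x).2 (by simp [h])]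
    simp
  · rw [Real.sign_of_pos h, (H1 x).2 (by simp [h.le]), (H2 x).1 (by simp [hx, h, h.ne'])]
    simp

/-- Key perturbation lemma. -/
lemma aux_perturb {n : ℕ} {X : Set (Fin n → ℝ)} (hX : IsIrreducibleAlgSet X)
    (hdim : algDim X = (1 : WithBot ℕ∞)) (P : MvPolynomial (Fin n) ℝ)
    (hP : P ∉ vanishingIdealOf X) (a : Fin n → ℝ) (ha : eval a P = 0)
    (s : ℝ) (hs : s = 1 ∨ s = -1) (δ : ℝ) (hδ : 0 < δ)
    (hnear : ∀ x ∈ X, x ≠ a → (∀ i, |x i - a i| < δ) → Real.sign (eval x P) = s) :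
    ∃ h : MvPolynomial (Fin n) ℝ, Real.sign (eval a h) = s ∧
      ∀ x ∈ X, x ≠ a → Real.sign (eval x h) = Real.sign (eval x P) := by
  classical
  choose u G hu hG using aux_coord hX hdim P hP
  choose v hv hv' using fun i =>
    Polynomial.exists_eq_pow_rootMultiplicity_mul_and_not_dvd (u i) (hu i) (a i)
  set k : Fin n → ℕ := fun i => (u i).rootMultiplicity (a i) with hk
  let w : Fin n → MvPolynomial (Fin n) ℝ := fun i => Polynomial.aeval (MvPolynomial.X i) (v i)
  have hw : ∀ i x, eval x (w i) = (v i).eval (x i) := by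
    intro i x
    have h2 := Polynomial.aeval_algHom_apply
      (MvPolynomial.aeval x : MvPolynomial (Fin n) ℝ →ₐ[ℝ] ℝ) (MvPolynomial.X i) (v i)
    simpa [w, MvPolynomial.aeval_eq_eval, Polynomial.aeval_def] using h2.symm
  let V : MvPolynomial (Fin n) ℝ := ∏ i, (w i) ^ 2
  let E : Fin n → MvPolynomial (Fin n) ℝ := fun i => ∏ j ∈ Finset.univ.erase i, (w j) ^ 2
  let y : Fin n → MvPolynomial (Fin n) ℝ := fun i => C ((δ ^ (2 * k i))⁻¹) * P * (G i) ^ 2 * E i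
  let W : MvPolynomial (Fin n) ℝ := 1 + ∑ i, (y i) ^ 2
  have hVE : ∀ i x, eval x V = (eval x (w i)) ^ 2 * eval x (E i) := by
    intro i x
    simp only [V, E, map_prod, map_pow]
    rw [Finset.mul_prod_erase _ (fun j => eval x (w j) ^ 2) (Finset.mem_univ i)]
  have hE : ∀ i x, 0 ≤ eval x (E i) := by
    intro i x
    simp only [E, map_prod, map_pow]
    exact Finset.prod_nonneg fun j _ => sq_nonneg _
  have hV : ∀ x, 0 ≤ eval x V := by
    intro x
    simp only [V, map_prod, map_pow]
    exact Finset.prod_nonneg fun j _ => sq_nonneg _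
  have hVa : 0 < eval a V := by
    simp only [V, map_prod, map_pow]
    refine Finset.prod_pos fun j _ => ?_
    have : eval a (w j) ≠ 0 := by
      rw [hw]
      intro h
      exact hv' j (Polynomial.dvd_iff_isRoot.mpr h)
    positivity
  have hW : ∀ i x, |eval x (y i)| < eval x W := by
    intro i x
    have h1 : (eval x (y i)) ^ 2 ≤ ∑ i, (eval x (y i)) ^ 2 :=
      Finset.single_le_sum (f := fun i => (eval x (y i)) ^ 2) (fun j _ => sq_nonneg _)
        (Finset.mem_univ i)
    have h2 : eval x W = 1 + ∑ i, (eval x (y i)) ^ 2 := by simp [W]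
    rw [h2]
    have h3 : |eval x (y i)| ^ 2 = (eval x (y i)) ^ 2 := sq_abs _
    nlinarith [sq_nonneg (|eval x (y i)| - 1), abs_nonneg (eval x (y i))]
  have hWpos : ∀ x, 0 < eval x W := by
    intro x
    have h2 : eval x W = 1 + ∑ i, (eval x (y i)) ^ 2 := by simp [W]
    rw [h2]
    have : 0 ≤ ∑ i, (eval x (y i)) ^ 2 := Finset.sum_nonneg fun j _ => sq_nonneg _
    linarith
  have hfar : ∀ x ∈ X, (∃ i, δ ≤ |x i - a i|) → ∃ i, eval x V ≤ |eval x P| * |eval x (y i)| := by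
    rintro x hx ⟨i, hi⟩
    refine ⟨i, ?_⟩
    have e1 : (x i - a i) ^ (k i) * eval x (w i) = eval x P * eval x (G i) := by
      have := congrArg (Polynomial.eval (x i)) (hv i)
      rw [← hG i x hx, this, hw]
      simp [hk]
    have e2 : (x i - a i) ^ (2 * k i) * eval x (w i) ^ 2 = eval x P ^ 2 * eval x (G i) ^ 2 := by
      rw [mul_comm 2, pow_mul, ← mul_pow, e1, mul_pow]
    have e3 : δ ^ (2 * k i) ≤ (x i - a i) ^ (2 * k i) := by
      rw [pow_mul, pow_mul (x i - a i), ← sq_abs (x i - a i)]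
      gcongr
    have e4 : δ ^ (2 * k i) * eval x (w i) ^ 2 ≤ eval x P ^ 2 * eval x (G i) ^ 2 := by
      rw [← e2]
      gcongr
    have e5 : eval x (w i) ^ 2 ≤ (δ ^ (2 * k i))⁻¹ * (eval x P ^ 2 * eval x (G i) ^ 2) := by
      rw [le_inv_mul_iff₀ (by positivity)]
      exact e4
    have e6 : |eval x P| * |eval x (y i)| =
        (δ ^ (2 * k i))⁻¹ * (eval x P ^ 2 * eval x (G i) ^ 2) * eval x (E i) := by
      rw [← abs_mul]
      have : eval x P * eval x (y i) =
        (δ ^ (2 * k i))⁻¹ * (eval x P ^ 2 * eval x (G i) ^ 2) * eval x (E i) := by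
        simp only [y, map_mul, eval_C, map_pow]
        ring
      rw [this, abs_of_nonneg]
      have := hE i x
      positivity
    rw [hVE i, e6]
    exact mul_le_mul_of_nonneg_right e5 (hE i x)
  refine ⟨P * W + C s * V, ?_, ?_⟩
  · simp only [map_add, map_mul, eval_C, ha, zero_mul, zero_add]
    rcases hs with rfl | rfl
    · rw [one_mul]; exact Real.sign_of_pos hVa
    · exact Real.sign_of_neg (by linarith)
  · intro x hx hxa
    simp only [map_add, map_mul, eval_C]
    have hWx := hWpos x
    have hVx := hV x
    by_cases hn : ∀ i, |x i - a i| < δ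
    · have hsx := hnear x hx hxa hn
      rw [hsx]
      rcases hs with rfl | rfl
      · have : 0 < eval x P := by
          rcases lt_trichotomy (eval x P) 0 with h | h | h
          · rw [Real.sign_of_neg h] at hsx; norm_num at hsx
          · rw [h] at hsx; simp at hsx
          · exact h
        exact Real.sign_of_pos (by positivity)
      · have : eval x P < 0 := by
          rcases lt_trichotomy (eval x P) 0 with h | h | h
          · exact h
          · rw [h] at hsx; simp at hsx
          · rw [Real.sign_of_pos h] at hsx; norm_num at hsx
        exact Real.sign_of_neg (by nlinarith [mul_pos_of_neg_of_neg this (neg_lt_zero.mpr hWx)])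
    · push Not at hn
      obtain ⟨i, hi⟩ := hfar x hx hn
      have hyi := hW i x
      have hsV : |s * eval x V| = eval x V := by
        rw [abs_mul, abs_of_nonneg hVx]
        rcases hs with rfl | rfl <;> simp
      rcases lt_trichotomy (eval x P) 0 with h | h | h
      · rw [Real.sign_of_neg h]
        apply Real.sign_of_neg
        rw [abs_of_neg h] at hi
        have := mul_lt_mul_of_pos_left hyi (neg_pos.mpr h)
        have := le_abs_self (s * eval x V)
        linarith
      · rw [h] at hi ⊢
        have : eval x V = 0 := le_antisymm (by simpa using hi) hVx
        simp [this]
      · rw [Real.sign_of_pos h]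
        apply Real.sign_of_pos
        rw [abs_of_pos h] at hi
        have := mul_lt_mul_of_pos_left hyi h
        have := neg_abs_le (s * eval x V)
        linarith

lemma aux_caseB {n : ℕ} {X : Set (Fin n → ℝ)} (hX : IsIrreducibleAlgSet X)
    (hdim : algDim X = (1 : WithBot ℕ∞)) (f : (Fin n → ℝ) → ℝ) (hf : ContinuousOn f X)
    (hN : {x ∈ X | f x ≠ 0}.Infinite) (m : ℕ) :
    ∀ P : MvPolynomial (Fin n) ℝ, {x ∈ X | Real.sign (f x) ≠ Real.sign (eval x P)}.Finite →
      {x ∈ X | Real.sign (f x) ≠ Real.sign (eval x P)}.ncard ≤ m →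
      ∃ h : MvPolynomial (Fin n) ℝ, ∀ x ∈ X, Real.sign (f x) = Real.sign (eval x h) := by
  have hmem : ∀ P : MvPolynomial (Fin n) ℝ,
      {x ∈ X | Real.sign (f x) ≠ Real.sign (eval x P)}.Finite → P ∉ vanishingIdealOf X := by
    intro P hfin hP
    apply hN
    refine hfin.subset ?_
    rintro x ⟨hx, h⟩
    refine ⟨hx, ?_⟩
    rw [hP x hx, Real.sign_zero]
    rwa [Ne, Real.sign_eq_zero_iff]
  induction m with
  | zero =>
    intro P hfin hc
    refine ⟨P, fun x hx => ?_⟩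
    rw [Nat.le_zero, Set.ncard_eq_zero hfin] at hc
    by_contra h
    exact (Set.mem_empty_iff_false x).mp (hc ▸ ⟨hx, h⟩)
  | succ m ih =>
    intro P hfin hc
    set B := {x ∈ X | Real.sign (f x) ≠ Real.sign (eval x P)} with hB
    rcases B.eq_empty_or_nonempty with hempty | ⟨a, haB⟩
    · apply ih P hfin
      rw [← hB, hempty]; simp
    -- it suffices to fix the sign at `a`
    have step : ∀ h : MvPolynomial (Fin n) ℝ, Real.sign (eval a h) = Real.sign (f a) →
        (∀ x ∈ X, x ≠ a → Real.sign (eval x h) = Real.sign (eval x P)) →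
        ∃ h : MvPolynomial (Fin n) ℝ, ∀ x ∈ X, Real.sign (f x) = Real.sign (eval x h) := by
      intro h h1 h2
      have hsub : {x ∈ X | Real.sign (f x) ≠ Real.sign (eval x h)} ⊆ B \ {a} := by
        rintro x ⟨hx, hne⟩
        have hxa : x ≠ a := by
          rintro rfl
          exact hne h1.symm
        refine ⟨⟨hx, ?_⟩, hxa⟩
        rwa [h2 x hx hxa] at hne
      refine ih h ((hfin.sdiff).subset hsub) ?_
      have l1 := Set.ncard_le_ncard hsub hfin.sdiff
      have l2 := Set.ncard_sdiff_singleton_lt_of_mem haB hfin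
      omega
    have hsq : ∀ x ∈ X, x ≠ a →
        Real.sign (eval x (auxSq a * P)) = Real.sign (eval x P) := by
      intro x _ hxa
      rw [map_mul]
      exact aux_sign_pos_mul (auxSq_pos a x hxa)
    have hsqa : eval a (auxSq a * P) = 0 := by rw [map_mul, auxSq_self, zero_mul]
    by_cases hfa : f a = 0
    · apply step (auxSq a * P) _ hsq
      rw [hsqa, hfa]
    · have hmem' : auxSq a * P ∉ vanishingIdealOf X := by
        apply hmem
        refine hfin.subset ?_
        rintro x ⟨hx, hne⟩
        by_cases hxa : x = a
        · rw [hxa]; exact haB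
        · refine ⟨hx, ?_⟩
          rwa [hsq x hx hxa] at hne
      have hev : ∀ᶠ x in nhdsWithin a X, Real.sign (f x) = Real.sign (f a) := by
        have hc := hf a haB.1
        rcases lt_or_gt_of_ne hfa with h | h
        · filter_upwards [hc.eventually (gt_mem_nhds h)] with x hx
          rw [Real.sign_of_neg h, Real.sign_of_neg hx]
        · filter_upwards [hc.eventually (lt_mem_nhds h)] with x hx
          rw [Real.sign_of_pos h, Real.sign_of_pos hx]
      have hev2 : ∀ᶠ x in nhds a, x ∉ B \ {a} :=
        (hfin.sdiff.isClosed.isOpen_compl).mem_nhds (by simp)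
      rw [eventually_nhdsWithin_iff] at hev
      obtain ⟨δ, hδ, hball⟩ := Metric.eventually_nhds_iff.mp (hev.and hev2)
      obtain ⟨h, h1, h2⟩ := aux_perturb hX hdim (auxSq a * P) hmem' a hsqa (Real.sign (f a))
        ((Real.sign_apply_eq_of_ne_zero _ hfa).symm) δ hδ (by
          intro x hx hxa hclose
          have hd : dist x a < δ := by
            rw [dist_pi_lt_iff hδ]
            intro i
            rw [Real.dist_eq]; exact hclose i
          obtain ⟨g1, g2⟩ := hball hd
          rw [hsq x hx hxa, ← g1 hx]
          by_contra hne
          exact g2 ⟨⟨hx, fun e => hne e.symm⟩, hxa⟩)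
      exact step h h1 (fun x hx hxa => (h2 x hx hxa).trans (hsq x hx hxa))

/-- on an irreducible real algebraic curve, the sign of a regulous function is a
sum of at most two signs of polynomial functions. -/
theorem sign_regulous_curve_two_polys {n : ℕ} (X : Set (Fin n → ℝ))
    (hX : IsIrreducibleAlgSet X) (hdim : algDim X = (1 : WithBot ℕ∞))
    (f : (Fin n → ℝ) → ℝ) (hf : IsRegulousOn X f) :
    ∃ h₁ h₂ : MvPolynomial (Fin n) ℝ,
      ∀ x ∈ X, Real.sign (f x) =
        Real.sign (MvPolynomial.eval x h₁) + Real.sign (MvPolynomial.eval x h₂) := by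
  rcases X.eq_empty_or_nonempty with rfl | hne
  · exact ⟨0, 0, fun x hx => absurd hx (Set.notMem_empty x)⟩
  by_cases hN : {x ∈ X | f x ≠ 0}.Finite
  · exact aux_caseA f hN
  obtain ⟨p, q, hq, hpq⟩ := aux_rational hf hne
  have hcont : ContinuousOn f X := by
    obtain ⟨g, ⟨hg, -⟩, hfg⟩ := hf
    exact hg.continuousOn.congr hfg
  obtain ⟨h, hh⟩ := aux_caseB hX hdim f hcont hN _ (p * q)
    ((aux_finite hX hdim q hq).subset (by
      rintro x ⟨hx, hs⟩
      refine ⟨hx, ?_⟩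
      by_contra h0
      apply hs
      have e : eval x (p * q) = (eval x q) ^ 2 * f x := by
        rw [map_mul, hpq x hx]; ring
      rw [e, aux_sign_pos_mul (by positivity)])) le_rfl
  exact ⟨h, 0, fun x hx => by rw [hh x hx]; simp⟩
end
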